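/- arXiv:1508.02335 — 2 statements merged into one kernel-verified Lean document; each statement's English description precedes it below -/
import Mathlib

section
/- Let (X, 𝓑, T) be a Borel system and A ∈ 𝓑. Then the restriction of T to the T-invariant Borel set div(A) admits a 4-set generator. -/
open Filter
open scoped Classical

/-- The frequency of visits of the first `N` points of the forward orbit of `x` to `A`:
`S_N(x,A) = (1/N) · #{0 ≤ i < N : T^i x ∈ A}`. -/
noncomputable def visitFreq {X : Type*} (T : Equiv.Perm X) (A : Set X) (x : X) (N : ℕ) : ℝ :=
  (∑ i ∈ Finset.range N, if (T ^ i) x ∈ A then (1 : ℝ) else 0) / N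

/-- The set of `A`-divergent points: those `x` for which `S_N(x,A)` fails to converge. -/
def divSet {X : Type*} (T : Equiv.Perm X) (A : Set X) : Set X :=
  {x | ¬ ∃ L : ℝ, Tendsto (visitFreq T A x) atTop (nhds L)}

/-- `Y` admits a `k`-set generator for (the restriction of) `T`: there is a partition of `Y`
into `k` Borel sets `A_1, …, A_k` such that the σ-algebra on `Y` generated by all the sets
`T^n A_i` equals the trace σ-algebra. -/
def IsGeneratorOn {X : Type*} [MeasurableSpace X] (T : Equiv.Perm X) (Y : Set X) (k : ℕ) :
    Prop :=
  ∃ A : Fin k → Set X,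
    (∀ i, MeasurableSet (A i)) ∧
    (∀ i, A i ⊆ Y) ∧
    (Pairwise fun i j => Disjoint (A i) (A j)) ∧
    (⋃ i, A i) = Y ∧
    MeasurableSpace.generateFrom
        {s : Set Y | ∃ (n : ℤ) (i : Fin k), s = Subtype.val ⁻¹' (⇑(T ^ n) '' A i)}
      = (inferInstance : MeasurableSpace Y)

section Matching

variable {Ω : Type*} (S : Equiv.Perm Ω) (u v : Ω → ℕ)

/-- Read along the forward orbit of `ω`, a stack receives `u` items at each point and then loses
`v` items there. This is the number of items lying above a given item pushed at `ω` with `r` items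
above it, once the items at `S ^ j ω` have been pushed and before any is removed there. -/
def stackHeight (ω : Ω) (r j : ℕ) : ℤ :=
  r + ∑ i ∈ Finset.range j, (u ((S ^ (i + 1)) ω) : ℤ) - ∑ i ∈ Finset.range j, (v ((S ^ i) ω) : ℤ)

theorem exists_popTime (ω : Ω) (r : ℕ) :
    ∃ j, stackHeight S u v ω r j < v ((S ^ j) ω) ∨
      ∀ i, ¬ stackHeight S u v ω r i < v ((S ^ i) ω) := by
  by_cases h : ∃ j, stackHeight S u v ω r j < v ((S ^ j) ω)
  · exact h.imp fun _ => Or.inl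
  · exact ⟨0, Or.inr (not_exists.1 h)⟩

/-- The time at which the item pushed at `ω` with `r` items above it is removed (`0` if never). -/
noncomputable def popTime (ω : Ω) (r : ℕ) : ℕ := Nat.find (exists_popTime S u v ω r)

/-- The rank of an item among those removed at the same point. -/
noncomputable def popRank (ω : Ω) (r : ℕ) : ℕ := (stackHeight S u v ω r (popTime S u v ω r)).toNat

/-- Sends an item to the point and the rank at which it is removed. -/
noncomputable def popMap (p : Ω × ℕ) : Ω × ℕ :=
  ((S ^ popTime S u v p.1 p.2) p.1, popRank S u v p.1 p.2)

/-- On some nonempty initial segment of the forward orbit of `ω`, the total of `u` is at most the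
total of `v`. -/
def Dominated (ω : Ω) : Prop :=
  ∃ L : ℕ, 0 < L ∧
    ∑ i ∈ Finset.range L, u ((S ^ i) ω) ≤ ∑ i ∈ Finset.range L, v ((S ^ i) ω)

variable {S u v}

theorem stackHeight_zero (ω : Ω) (r : ℕ) : stackHeight S u v ω r 0 = r := by
  simp [stackHeight]

theorem stackHeight_succ (ω : Ω) (r j : ℕ) :
    stackHeight S u v ω r (j + 1) =
      stackHeight S u v ω r j + u ((S ^ (j + 1)) ω) - v ((S ^ j) ω) := by
  simp only [stackHeight, Finset.sum_range_succ]
  ring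

theorem stackHeight_add (ω : Ω) (r r' d j : ℕ) :
    stackHeight S u v ω r (d + j) =
      stackHeight S u v ω r d + stackHeight S u v ((S ^ d) ω) r' j - r' := by
  induction j with
  | zero => simp [stackHeight_zero]
  | succ j ih =>
    rw [← add_assoc, stackHeight_succ, stackHeight_succ, ih, ← Equiv.Perm.mul_apply,
      ← Equiv.Perm.mul_apply, ← pow_add, ← pow_add, show j + 1 + d = d + j + 1 by ring,
      add_comm j d]
    ring

theorem Dominated.stackHeight_popTime_lt {ω : Ω} {r : ℕ} (h : Dominated S u v ω) (hr : r < u ω) :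
    stackHeight S u v ω r (popTime S u v ω r) < v ((S ^ popTime S u v ω r) ω) := by
  refine (Nat.find_spec (exists_popTime S u v ω r)).resolve_right fun hn => ?_
  obtain ⟨L, hL, hsum⟩ := h
  obtain ⟨j, rfl⟩ := Nat.exists_eq_succ_of_ne_zero hL.ne'
  apply hn j
  rw [Nat.succ_eq_add_one, Finset.sum_range_succ', Finset.sum_range_succ _ j] at hsum
  simp only [stackHeight]
  have h1 : (u ((S ^ 0) ω) : ℕ) = u ω := by simp
  have h2 := Int.ofNat_le.2 hsum
  simp only [Nat.cast_add, Nat.cast_sum, h1] at h2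
  linarith [Int.ofNat_lt.2 hr]

theorem le_stackHeight_of_lt_popTime {ω : Ω} {r j : ℕ} (h : j < popTime S u v ω r) :
    (v ((S ^ j) ω) : ℤ) ≤ stackHeight S u v ω r j := by
  have := Nat.find_min (exists_popTime S u v ω r) h
  push Not at this
  exact this.1

theorem le_stackHeight_of_le_popTime {ω : Ω} {r j : ℕ} (hj : 0 < j)
    (h : j ≤ popTime S u v ω r) :
    (u ((S ^ j) ω) : ℤ) ≤ stackHeight S u v ω r j := by
  obtain ⟨j, rfl⟩ := Nat.exists_eq_succ_of_ne_zero hj.ne'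
  have := le_stackHeight_of_lt_popTime (Nat.lt_of_succ_le h)
  rw [Nat.succ_eq_add_one, stackHeight_succ]
  linarith

theorem stackHeight_popTime_nonneg (ω : Ω) (r : ℕ) :
    0 ≤ stackHeight S u v ω r (popTime S u v ω r) := by
  rcases Nat.eq_zero_or_pos (popTime S u v ω r) with h | h
  · rw [h, stackHeight_zero]
    positivity
  · exact (Int.natCast_nonneg _).trans (le_stackHeight_of_le_popTime h le_rfl)

theorem Dominated.popMap_snd_lt {p : Ω × ℕ} (h : Dominated S u v p.1) (hr : p.2 < u p.1) :
    (popMap S u v p).2 < v (popMap S u v p).1 := by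
  have h1 := h.stackHeight_popTime_lt hr
  have h2 := stackHeight_popTime_nonneg (S := S) (u := u) (v := v) p.1 p.2
  simp only [popMap, popRank]
  omega

theorem popMap_injOn : Set.InjOn (popMap S u v) {p | p.2 < u p.1} := by
  have key : ∀ p q : Ω × ℕ, q.2 < u q.1 → popMap S u v p = popMap S u v q →
      popTime S u v q.1 q.2 ≤ popTime S u v p.1 p.2 → p = q := by
    rintro ⟨ω, r⟩ ⟨ω', r'⟩ hq h hle
    obtain ⟨d, hd⟩ := Nat.exists_eq_add_of_le' hle
    simp only [popMap, popRank, Prod.mk.injEq] at h hd hq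
    obtain ⟨h1, h2⟩ := h
    have h3 : ω' = (S ^ d) ω := by
      rw [hd, add_comm, pow_add, Equiv.Perm.mul_apply] at h1
      exact ((S ^ _).injective h1).symm
    have h4 : stackHeight S u v ω r d = r' := by
      have e1 := stackHeight_popTime_nonneg (S := S) (u := u) (v := v) ω r
      have e2 := stackHeight_popTime_nonneg (S := S) (u := u) (v := v) ω' r'
      have e3 := stackHeight_add (S := S) (u := u) (v := v) ω r r' d (popTime S u v ω' r')
      rw [← h3, ← hd] at e3
      omega
    rcases Nat.eq_zero_or_pos d with rfl | hpos
    · rw [stackHeight_zero] at h4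
      simp only [pow_zero, Equiv.Perm.coe_one, id_eq] at h3
      rw [h3, Nat.cast_injective h4]
    · have := le_stackHeight_of_le_popTime hpos (hd ▸ Nat.le_add_right d _ :
        d ≤ popTime S u v ω r)
      rw [h4, ← h3] at this
      omega
  intro p hp q hq h
  rcases le_total (popTime S u v q.1 q.2) (popTime S u v p.1 p.2) with hle | hle
  · exact key p q hq h hle
  · exact (key q p hp h.symm hle).symm

section Measurability

variable [MeasurableSpace Ω]

theorem measurable_perm_pow (hS : Measurable S) (n : ℕ) : Measurable ⇑(S ^ n) := by
  rw [Equiv.Perm.coe_pow]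
  exact hS.iterate n

theorem measurable_stackHeight (hS : Measurable S) (hu : Measurable u)
    (hv : Measurable v) (r j : ℕ) :
    Measurable fun ω => stackHeight S u v ω r j := by
  have := fun n => measurable_perm_pow hS n
  unfold stackHeight
  fun_prop

theorem measurableSet_dominated (hS : Measurable S) (hu : Measurable u)
    (hv : Measurable v) :
    MeasurableSet {ω | Dominated S u v ω} := by
  have := fun n => measurable_perm_pow hS n
  unfold Dominated
  measurability

theorem measurable_popTime (hS : Measurable S) (hu : Measurable u)
    (hv : Measurable v) (r : ℕ) :
    Measurable fun ω => popTime S u v ω r := by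
  have h1 := measurable_stackHeight hS hu hv r
  have h2 : ∀ j, Measurable fun ω => (v ((S ^ j) ω) : ℤ) := fun j => by
    have := measurable_perm_pow hS j
    fun_prop
  refine measurable_find (fun ω => exists_popTime S u v ω r) fun k => ?_
  have h3 : ∀ j, MeasurableSet {ω | stackHeight S u v ω r j < v ((S ^ j) ω)} := fun j =>
    measurableSet_lt (h1 j) (h2 j)
  have h4 : MeasurableSet {ω | ∀ i, ¬ stackHeight S u v ω r i < v ((S ^ i) ω)} := by
    measurability
  exact (h3 k).union h4

theorem measurable_stackHeight_popTime (hS : Measurable S) (hu : Measurable u)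
    (hv : Measurable v) (r : ℕ) :
    Measurable fun ω => stackHeight S u v ω r (popTime S u v ω r) := by
  have hb : Measurable fun x : Ω × ℕ => stackHeight S u v x.1 r x.2 :=
    measurable_from_prod_countable_left fun j => measurable_stackHeight hS hu hv r j
  have := hb.comp (measurable_id.prodMk (measurable_popTime hS hu hv r))
  exact this

theorem measurable_popRank (hS : Measurable S) (hu : Measurable u)
    (hv : Measurable v) (r : ℕ) :
    Measurable fun ω => popRank S u v ω r := by
  have := measurable_stackHeight_popTime hS hu hv r
  exact (measurable_of_countable Int.toNat).comp this

end Measurability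

end Matching

section Coding

variable {Ω : Type*} [MeasurableSpace Ω]

/-- `ω ∈ R j d` means that the `j`-th bit of information about `ω` is stored at `S ^ d ω`; distinct
bits, of the same or of distinct points, are stored at distinct places. -/
structure IsCoding (S : Equiv.Perm Ω) (R : ℕ → ℕ → Set Ω) : Prop where
  measurableSet : ∀ j d, MeasurableSet (R j d)
  eq_of_eq : ∀ {j j' d d' ω ω'}, ω ∈ R j d → ω' ∈ R j' d' → (S ^ d) ω = (S ^ d') ω' →
    j = j' ∧ d = d'

variable {S : Equiv.Perm Ω}

theorem measurable_perm_zpow (hS : Measurable S) (hS' : Measurable S.symm) (n : ℤ) :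
    Measurable ⇑(S ^ n) := by
  obtain ⟨k, rfl | rfl⟩ := n.eq_nat_or_neg
  · rw [zpow_natCast]
    exact measurable_perm_pow hS k
  · rw [zpow_neg, zpow_natCast, ← inv_pow]
    exact measurable_perm_pow (S := S⁻¹) hS' k

theorem exists_isCoding_of_forall (hS : Measurable S) (hS' : Measurable S.symm)
    {R : ℕ → ℕ → ℕ → Set Ω} (hR : ∀ t, IsCoding S (R t)) :
    ∃ R' : ℕ → ℕ → Set Ω, IsCoding S R' ∧
      ∀ ω, (∃ t, ∀ j, ∃ d, ω ∈ R t j d) → ∃ n : ℤ, ∀ j, ∃ d, (S ^ n) ω ∈ R' j d := by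
  let F : ℕ → Set Ω := fun t => {ω | ∃ n : ℤ, ∀ j, ∃ d, (S ^ n) ω ∈ R t j d}
  have hFm : ∀ t, MeasurableSet (F t) := fun t =>
    (Measurable.exists fun n => Measurable.forall fun j => Measurable.exists fun d =>
      ((hR t).measurableSet j d).mem.comp (measurable_perm_zpow hS hS' n)).setOf
  have hFS : ∀ t ω (n : ℤ), ω ∈ F t → (S ^ n) ω ∈ F t := by
    rintro t ω n ⟨m, hm⟩
    refine ⟨m - n, fun j => ?_⟩
    rw [← Equiv.Perm.mul_apply, ← zpow_add, sub_add_cancel]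
    exact hm j
  have hFd : ∀ t ω ω' (d d' : ℕ), (S ^ d) ω = (S ^ d') ω' → ω ∈ F t → ω' ∈ F t := by
    intro t ω ω' d d' h hω
    have : ω' = (S ^ (-d' + d : ℤ)) ω := by
      rw [zpow_add, Equiv.Perm.mul_apply, zpow_natCast, h, zpow_neg, zpow_natCast]
      simp
    rw [this]
    exact hFS t ω _ hω
  refine ⟨fun j d => {ω | ∃ t, ω ∈ R t j d ∧ ω ∈ F t ∧ ∀ s < t, ω ∉ F s}, ⟨fun j d => ?_, ?_⟩, ?_⟩
  · exact (Measurable.exists fun t => ((hR t).measurableSet j d).mem.and ((hFm t).mem.and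
      (Measurable.forall fun s => Measurable.forall fun _ => (hFm s).mem.not))).setOf
  · rintro j j' d d' ω ω' ⟨t, h1, h2, h3⟩ ⟨t', h1', h2', h3'⟩ h
    have : t = t' := by
      rcases lt_trichotomy t t' with hlt | heq | hlt
      · exact absurd (hFd t ω ω' d d' h h2) (h3' t hlt)
      · exact heq
      · exact absurd (hFd t' ω' ω d' d h.symm h2') (h3 t' hlt)
    subst this
    exact (hR t).eq_of_eq h1 h1' h
  · rintro ω ⟨t, ht⟩
    have hex : ∃ t, ω ∈ F t := ⟨t, 0, by simpa using ht⟩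
    obtain ⟨n, hn⟩ := Nat.find_spec hex
    refine ⟨n, fun j => ?_⟩
    obtain ⟨d, hd⟩ := hn j
    refine ⟨d, Nat.find hex, hd, hFS _ _ _ (Nat.find_spec hex), fun s hs hF => ?_⟩
    refine Nat.find_min hex hs ?_
    simpa [← Equiv.Perm.mul_apply, ← zpow_add] using hFS s _ (-n) hF

end Coding

section Compression

theorem iterate_eq_iterate_of_injOn {γ : Type*} {f : γ → γ} {D B : Set γ} (hf : Set.InjOn f D)
    (hD : Set.MapsTo f D (D \ B)) {x y : γ} (hx : x ∈ D) (hy : y ∈ D) (hxB : x ∈ B) (hyB : y ∈ B)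
    {n k : ℕ} (h : f^[n] x = f^[k] y) : n = k ∧ x = y := by
  have hDD : Set.MapsTo f D D := fun z hz => (hD hz).1
  induction n generalizing k with
  | zero =>
    cases k with
    | zero => exact ⟨rfl, h⟩
    | succ k =>
      rw [Function.iterate_succ_apply', Function.iterate_zero_apply] at h
      exact absurd hxB (h ▸ (hD (hDD.iterate k hy)).2)
  | succ n ih =>
    cases k with
    | zero =>
      rw [Function.iterate_succ_apply', Function.iterate_zero_apply] at h
      exact absurd hyB (h ▸ (hD (hDD.iterate n hx)).2)
    | succ k =>
      rw [Function.iterate_succ_apply', Function.iterate_succ_apply'] at h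
      obtain ⟨rfl, rfl⟩ := ih (hf (hDD.iterate n hx) (hDD.iterate k hy) h)
      exact ⟨rfl, rfl⟩

variable {Ω : Type*} (S : Equiv.Perm Ω) (A : Set Ω)

/-- The function equal to `m` on `A` and to `0` elsewhere. -/
noncomputable def weightOn (m : ℕ) (ω : Ω) : ℕ := if ω ∈ A then m else 0

/-- The points whose whole forward orbit sees averages of `weightOn A m` that are at least `a + 1`
and averages that are at most `a`. -/
def crossingSet (a m : ℕ) : Set Ω :=
  {ω | ∀ p : ℕ, Dominated S (fun _ => a + 1) (weightOn A m) ((S ^ p) ω) ∧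
    Dominated S (weightOn A m) (fun _ => a) ((S ^ p) ω)}

/-- On `crossingSet S A a m`, this embeds `a + 1` copies of the space into `a` copies along the
orbits of `S`. -/
noncomputable def compress (a m : ℕ) (p : Ω × ℕ) : Ω × ℕ :=
  popMap S (weightOn A m) (fun _ => a) (popMap S (fun _ => a + 1) (weightOn A m) p)

/-- The effect of `popMap` at a point `S ^ q.1 ω`, with points recorded by their times along the
forward orbit of `ω`. -/
noncomputable def advance (u v : Ω → ℕ) (ω : Ω) (q : ℕ × ℕ) : ℕ × ℕ :=
  (q.1 + popTime S u v ((S ^ q.1) ω) q.2, popRank S u v ((S ^ q.1) ω) q.2)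

/-- The iterates of `compress` at `(ω, a)`, with points recorded by their times. -/
noncomputable def track (a m : ℕ) (ω : Ω) : ℕ → ℕ × ℕ
  | 0 => (0, a)
  | n + 1 => advance S (weightOn A m) (fun _ => a) ω
      (advance S (fun _ => a + 1) (weightOn A m) ω (track a m ω n))

/-- The points of `crossingSet S A a m` whose track reaches rank `r` for the `j`-th time at
time `d`. -/
def rankCoding (a m r j d : ℕ) : Set Ω :=
  {ω | ω ∈ crossingSet S A a m ∧ ∃ n, track S A a m ω (n + 1) = (d, r) ∧
    ∑ k ∈ Finset.range n, (if (track S A a m ω (k + 1)).2 = r then 1 else 0) = j}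

variable {S A}

theorem pow_mem_crossingSet {a m : ℕ} {ω : Ω} (h : ω ∈ crossingSet S A a m) (p : ℕ) :
    (S ^ p) ω ∈ crossingSet S A a m := fun q => by
  rw [← Equiv.Perm.mul_apply, ← pow_add]
  exact h _

theorem crossingSet_dominated {a m : ℕ} {ω : Ω} (h : ω ∈ crossingSet S A a m) :
    Dominated S (fun _ => a + 1) (weightOn A m) ω ∧ Dominated S (weightOn A m) (fun _ => a) ω := by
  simpa using h 0

theorem popMap_fst_mem_crossingSet {a m : ℕ} {p : Ω × ℕ} (u v : Ω → ℕ)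
    (h : p.1 ∈ crossingSet S A a m) : (popMap S u v p).1 ∈ crossingSet S A a m :=
  pow_mem_crossingSet h _

theorem compress_mapsTo (a m : ℕ) :
    Set.MapsTo (compress S A a m) {p | p.1 ∈ crossingSet S A a m ∧ p.2 < a + 1}
      ({p | p.1 ∈ crossingSet S A a m ∧ p.2 < a + 1} \ {p | p.2 = a}) := by
  rintro p ⟨hp, hr⟩
  have h1 := (crossingSet_dominated hp).1.popMap_snd_lt (p := p) hr
  have h2 := popMap_fst_mem_crossingSet (fun _ => a + 1) (weightOn A m) hp
  have h3 := (crossingSet_dominated h2).2.popMap_snd_lt h1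
  exact ⟨⟨popMap_fst_mem_crossingSet _ _ h2, h3.trans (Nat.lt_succ_self a)⟩, h3.ne⟩

theorem compress_injOn (a m : ℕ) :
    Set.InjOn (compress S A a m) {p | p.1 ∈ crossingSet S A a m ∧ p.2 < a + 1} := by
  rintro p ⟨hp, hr⟩ q ⟨hq, hs⟩ h
  exact popMap_injOn (u := fun _ => a + 1) hr hs (popMap_injOn
    ((crossingSet_dominated hp).1.popMap_snd_lt (p := p) hr)
    ((crossingSet_dominated hq).1.popMap_snd_lt (p := q) hs) h)

theorem pow_advance (u v : Ω → ℕ) (ω : Ω) (q : ℕ × ℕ) :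
    ((S ^ (advance S u v ω q).1) ω, (advance S u v ω q).2) = popMap S u v ((S ^ q.1) ω, q.2) := by
  simp only [advance, popMap]
  rw [add_comm, pow_add, Equiv.Perm.mul_apply]

theorem pow_track (a m : ℕ) (ω : Ω) (n : ℕ) :
    ((S ^ (track S A a m ω n).1) ω, (track S A a m ω n).2) = (compress S A a m)^[n] (ω, a) := by
  induction n with
  | zero => simp [track]
  | succ n ih =>
    rw [Function.iterate_succ_apply', ← ih, track, pow_advance, pow_advance, compress]

theorem track_snd_lt {a m : ℕ} {ω : Ω} (h : ω ∈ crossingSet S A a m) (n : ℕ) :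
    (track S A a m ω n).2 < a + 1 := by
  have hD : Set.MapsTo (compress S A a m) {p | p.1 ∈ crossingSet S A a m ∧ p.2 < a + 1}
      {p | p.1 ∈ crossingSet S A a m ∧ p.2 < a + 1} := fun p hp => (compress_mapsTo a m hp).1
  have := hD.iterate n (x := (ω, a)) ⟨h, Nat.lt_succ_self a⟩
  rw [← pow_track] at this
  exact this.2

theorem exists_rankCoding {a m : ℕ} {ω : Ω} (h : ω ∈ crossingSet S A a m) :
    ∃ r, ∀ j, ∃ d, ω ∈ rankCoding S A a m r j d := by
  obtain ⟨r, hr⟩ := Finite.exists_infinite_fiber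
    (fun n => (⟨(track S A a m ω (n + 1)).2, track_snd_lt h _⟩ : Fin (a + 1)))
  refine ⟨r, fun j => ?_⟩
  have hinf : {n | (track S A a m ω (n + 1)).2 = r}.Infinite := by
    rw [← Set.infinite_coe_iff]
    convert hr using 2
    ext n
    simp [Fin.ext_iff]
  refine ⟨(track S A a m ω (Nat.nth (fun n => (track S A a m ω (n + 1)).2 = r) j + 1)).1, h, _,
    Prod.ext rfl (Nat.nth_mem_of_infinite hinf j), ?_⟩
  rw [← Finset.card_filter, ← Nat.count_eq_card_filter_range]
  exact Nat.count_nth_of_infinite hinf j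

variable [MeasurableSpace Ω]

theorem measurable_advance {u v : Ω → ℕ} {q : Ω → ℕ × ℕ} (hS : Measurable S) (hu : Measurable u)
    (hv : Measurable v) (hq : Measurable q) :
    Measurable fun ω => advance S u v ω (q ω) := by
  have h1 : Measurable fun x : Ω × (ℕ × ℕ) => advance S u v x.1 x.2 := by
    refine measurable_from_prod_countable_left (f := fun x => advance S u v x.1 x.2) fun c => ?_
    have hd := measurable_perm_pow hS c.1
    have ht := measurable_popTime hS hu hv c.2
    have hr := measurable_popRank hS hu hv c.2
    exact ((ht.comp hd).const_add c.1).prodMk (hr.comp hd)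
  exact h1.comp (measurable_id.prodMk hq)

theorem measurable_weightOn (hA : MeasurableSet A) (m : ℕ) : Measurable (weightOn A m) :=
  Measurable.ite hA measurable_const measurable_const

theorem measurable_track (hS : Measurable S) (hA : MeasurableSet A) (a m n : ℕ) :
    Measurable fun ω => track S A a m ω n := by
  induction n with
  | zero => exact measurable_const
  | succ n ih =>
    exact measurable_advance hS (measurable_weightOn hA m) measurable_const
      (measurable_advance hS measurable_const (measurable_weightOn hA m) ih)

theorem measurableSet_crossingSet (hS : Measurable S) (hA : MeasurableSet A) (a m : ℕ) :
    MeasurableSet (crossingSet S A a m) := by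
  have hw := measurable_weightOn hA m
  exact (Measurable.forall fun p =>
    ((measurableSet_dominated hS measurable_const hw).mem.and
      (measurableSet_dominated hS hw measurable_const).mem).comp (measurable_perm_pow hS p)).setOf

theorem isCoding_rankCoding (hS : Measurable S) (hA : MeasurableSet A) (a m r : ℕ) :
    IsCoding S (rankCoding S A a m r) where
  measurableSet j d := by
    have hc := measurableSet_crossingSet hS hA a m
    have ht := measurable_track hS hA a m
    have hsum : ∀ n, Measurable fun ω => ∑ k ∈ Finset.range n,
        (if (track S A a m ω (k + 1)).2 = r then 1 else 0) := fun n =>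
      Finset.measurable_sum _ fun k _ => Measurable.ite
        ((ht (k + 1)).snd (measurableSet_singleton r)) measurable_const measurable_const
    exact (hc.mem.and (Measurable.exists fun n =>
      ((measurableSet_singleton (d, r)).mem.comp (ht (n + 1))).and
        ((measurableSet_singleton j).mem.comp (hsum n)))).setOf
  eq_of_eq := by
    rintro j j' d d' ω ω' ⟨hω, n, hn, rfl⟩ ⟨hω', n', hn', rfl⟩ h
    have e := pow_track (S := S) (A := A) a m ω (n + 1)
    have e' := pow_track (S := S) (A := A) a m ω' (n' + 1)
    rw [hn] at e
    rw [hn'] at e'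
    obtain ⟨h1, h2⟩ := iterate_eq_iterate_of_injOn (compress_injOn a m) (compress_mapsTo a m)
      (x := (ω, a)) (y := (ω', a)) ⟨hω, Nat.lt_succ_self a⟩ ⟨hω', Nat.lt_succ_self a⟩ rfl rfl
      (e.symm.trans ((congrArg (fun z => (z, r)) h).trans e'))
    obtain rfl : n = n' := by omega
    obtain rfl : ω = ω' := congrArg Prod.fst h2
    exact ⟨rfl, congrArg Prod.fst (hn.symm.trans hn')⟩

end Compression

section Divergence

variable {X : Type*} {T : Equiv.Perm X} {A : Set X}

theorem visitFreq_eq_birkhoffAverage (x : X) (N : ℕ) :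
    visitFreq T A x N = birkhoffAverage ℝ T (A.indicator fun _ => (1 : ℝ)) N x := by
  simp only [visitFreq, birkhoffAverage, birkhoffSum, Set.indicator_apply, Equiv.Perm.coe_pow,
    smul_eq_mul]
  rw [div_eq_inv_mul]

theorem mul_visitFreq (x : X) {N : ℕ} (hN : 0 < N) :
    visitFreq T A x N * N = ∑ i ∈ Finset.range N, if (T ^ i) x ∈ A then (1 : ℝ) else 0 := by
  rw [visitFreq, div_mul_cancel₀]
  exact_mod_cast hN.ne'

theorem visitFreq_nonneg (x : X) (N : ℕ) : 0 ≤ visitFreq T A x N :=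
  div_nonneg (Finset.sum_nonneg fun _ _ => by split_ifs <;> norm_num) N.cast_nonneg

theorem visitFreq_le_one (x : X) (N : ℕ) : visitFreq T A x N ≤ 1 := by
  refine div_le_one_of_le₀ ?_ N.cast_nonneg
  calc _ ≤ ∑ i ∈ Finset.range N, (1 : ℝ) :=
        Finset.sum_le_sum fun _ _ => by split_ifs <;> norm_num
    _ = N := by simp

theorem apply_mem_divSet_iff (x : X) : T x ∈ divSet T A ↔ x ∈ divSet T A := by
  have h : Tendsto (fun N => visitFreq T A (T x) N - visitFreq T A x N) atTop (nhds 0) := by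
    simp only [visitFreq_eq_birkhoffAverage]
    refine tendsto_birkhoffAverage_apply_sub_birkhoffAverage ℝ ?_
    refine Metric.isBounded_closedBall (x := (0 : ℝ)) (r := 1) |>.subset ?_
    rintro _ ⟨n, rfl⟩
    by_cases hn : T^[n] x ∈ A <;> simp [hn]
  refine not_congr ⟨fun ⟨L, hL⟩ => ⟨L, ?_⟩, fun ⟨L, hL⟩ => ⟨L, ?_⟩⟩
  · simpa using hL.sub h
  · simpa using hL.add h

theorem zpow_apply_mem_divSet {x : X} (hx : x ∈ divSet T A) (n : ℤ) :
    (T ^ n) x ∈ divSet T A := by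
  induction n with
  | zero => simpa using hx
  | succ n ih =>
    rw [add_comm, zpow_add, zpow_one, Equiv.Perm.mul_apply]
    exact (apply_mem_divSet_iff _).2 ih
  | pred n ih =>
    rw [← apply_mem_divSet_iff, ← Equiv.Perm.mul_apply, ← zpow_one_add]
    simpa using ih

theorem exists_mem_crossingSet {x : X} (hx : x ∈ divSet T A) :
    ∃ a m, x ∈ crossingSet T A a m := by
  obtain ⟨b, c, hbc, hb, hc⟩ : ∃ b c : ℝ, b < c ∧
      (∃ᶠ N in atTop, visitFreq T A x N < b) ∧ ∃ᶠ N in atTop, c < visitFreq T A x N := by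
    by_contra! H
    refine hx (tendsto_of_no_upcrossings dense_univ (fun b _ c _ hbc h => ?_) ?_ ?_)
    · exact h.2 (by simpa using H b c hbc h.1)
    · exact ⟨1, by simp [visitFreq_le_one]⟩
    · exact ⟨0, by simp [visitFreq_nonneg]⟩
  have hb0 : 0 ≤ b := by
    obtain ⟨N, hN⟩ := hb.exists
    exact (visitFreq_nonneg x N).trans hN.le
  obtain ⟨m, hm⟩ := exists_nat_gt (2 / (c - b))
  rw [div_lt_iff₀ (sub_pos.2 hbc)] at hm
  have ha1 := Nat.lt_floor_add_one (b * m)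
  have ha2 := Nat.floor_le (show 0 ≤ b * m by positivity)
  set a : ℕ := ⌊b * m⌋₊ + 1 with ha
  have hab : b * m < a := by rw [ha]; push_cast; exact ha1
  have hac : (a + 1 : ℝ) < c * m := by rw [ha]; push_cast; nlinarith
  have hshift : ∀ p L : ℕ, ((∑ i ∈ Finset.range L, weightOn A m ((T ^ i) ((T ^ p) x)) : ℕ) : ℝ) =
      m * ((∑ i ∈ Finset.range (p + L), if (T ^ i) x ∈ A then (1 : ℝ) else 0) -
        ∑ i ∈ Finset.range p, if (T ^ i) x ∈ A then (1 : ℝ) else 0) := by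
    intro p L
    rw [Finset.sum_range_add, add_sub_cancel_left, Finset.mul_sum]
    rw [Nat.cast_sum]
    refine Finset.sum_congr rfl fun i _ => ?_
    rw [weightOn, ← Equiv.Perm.mul_apply, ← pow_add, add_comm i p]
    split_ifs <;> simp
  refine ⟨a, m, fun p => ⟨?_, ?_⟩⟩
  · obtain ⟨M, hM⟩ := exists_nat_gt (m * p / (c * m - (a + 1)))
    rw [div_lt_iff₀ (sub_pos.2 hac)] at hM
    obtain ⟨N, hN, hcN⟩ := frequently_atTop.1 hc (M + p + 1)
    obtain ⟨L, rfl⟩ := Nat.exists_eq_add_of_le (show p ≤ N by omega)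
    refine ⟨L, by omega, ?_⟩
    rw [← Nat.cast_le (α := ℝ), hshift p L, ← mul_visitFreq x (by omega)]
    have h1 : (∑ i ∈ Finset.range p, if (T ^ i) x ∈ A then (1 : ℝ) else 0) ≤ p := by
      calc _ ≤ ∑ i ∈ Finset.range p, (1 : ℝ) :=
            Finset.sum_le_sum fun _ _ => by split_ifs <;> norm_num
        _ = p := by simp
    have h2 : c * ((p + L : ℕ) : ℝ) ≤ visitFreq T A x (p + L) * ((p + L : ℕ) : ℝ) := by gcongr
    have h3 : (M : ℝ) * (c * m - (a + 1)) ≤ ((p + L : ℕ) : ℝ) * (c * m - (a + 1)) := by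
      have := (sub_pos.2 hac).le
      gcongr
      omega
    have h4 := mul_le_mul_of_nonneg_left (sub_le_sub h2 h1) (Nat.cast_nonneg (α := ℝ) m)
    refine le_trans ?_ h4
    have h5 : (0 : ℝ) ≤ (a + 1) * p := by positivity
    simp only [Finset.sum_const, Finset.card_range, smul_eq_mul]
    push_cast at h3 ⊢
    linarith
  · obtain ⟨M, hM⟩ := exists_nat_gt (a * p / (a - b * m))
    rw [div_lt_iff₀ (sub_pos.2 hab)] at hM
    obtain ⟨N, hN, hbN⟩ := frequently_atTop.1 hb (M + p + 1)
    obtain ⟨L, rfl⟩ := Nat.exists_eq_add_of_le (show p ≤ N by omega)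
    refine ⟨L, by omega, ?_⟩
    rw [← Nat.cast_le (α := ℝ), hshift p L, ← mul_visitFreq x (by omega)]
    have h1 : 0 ≤ (∑ i ∈ Finset.range p, if (T ^ i) x ∈ A then (1 : ℝ) else 0) :=
      Finset.sum_nonneg fun _ _ => by split_ifs <;> norm_num
    have h2 : visitFreq T A x (p + L) * ((p + L : ℕ) : ℝ) ≤ b * ((p + L : ℕ) : ℝ) := by gcongr
    have h3 : (M : ℝ) * (a - b * m) ≤ ((p + L : ℕ) : ℝ) * (a - b * m) := by
      have := (sub_pos.2 hab).le
      gcongr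
      omega
    have h4 := mul_le_mul_of_nonneg_left (sub_le_sub h2 h1) (Nat.cast_nonneg (α := ℝ) m)
    refine h4.trans ?_
    simp only [Finset.sum_const, Finset.card_range, smul_eq_mul]
    push_cast at h3 ⊢
    linarith

theorem exists_isCoding_divSet [MeasurableSpace X] (hT : Measurable T) (hT' : Measurable T.symm)
    (hA : MeasurableSet A) :
    ∃ R : ℕ → ℕ → Set X, IsCoding T R ∧
      ∀ x ∈ divSet T A, ∃ n : ℤ, ∀ j, ∃ d, (T ^ n) x ∈ R j d := by
  obtain ⟨e, he⟩ := exists_surjective_nat (ℕ × ℕ × ℕ)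
  obtain ⟨R, hR, h⟩ := exists_isCoding_of_forall hT hT'
    (R := fun t => rankCoding T A (e t).1 (e t).2.1 (e t).2.2)
    fun t => isCoding_rankCoding hT hA _ _ _
  refine ⟨R, hR, fun x hx => h x ?_⟩
  obtain ⟨a, m, ham⟩ := exists_mem_crossingSet hx
  obtain ⟨r, hr⟩ := exists_rankCoding ham
  obtain ⟨t, ht⟩ := he (a, m, r)
  exact ⟨t, by simpa only [ht] using hr⟩

theorem measurableSet_divSet [MeasurableSpace X] (hT : Measurable T) (hA : MeasurableSet A) :
    MeasurableSet (divSet T A) := by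
  refine (MeasureTheory.measurableSet_exists_tendsto fun N => ?_).compl
  exact (Finset.measurable_sum _ fun i _ => Measurable.ite (measurable_perm_pow hT i hA)
    measurable_const measurable_const).div_const _

end Divergence

section Generator

/-- The shift on two-sided sequences of propositions. -/
def shiftPerm : Equiv.Perm (ℤ → Prop) where
  toFun ω i := ω (i + 1)
  invFun ω i := ω (i - 1)
  left_inv ω := by simp
  right_inv ω := by simp

theorem measurable_shiftPerm : Measurable shiftPerm :=
  measurable_pi_lambda _ fun _ => measurable_pi_apply _

theorem measurable_shiftPerm_symm : Measurable shiftPerm.symm :=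
  measurable_pi_lambda _ fun _ => measurable_pi_apply _

variable {X : Type*} (T : Equiv.Perm X) (A : Set X)

/-- The two-sided sequence of visits of the orbit of `x` to `A`. -/
def itinerary (x : X) (i : ℤ) : Prop := (T ^ i) x ∈ A

variable {T A}

theorem shiftPerm_itinerary (x : X) : shiftPerm (itinerary T A x) = itinerary T A (T x) := by
  funext i
  simp only [shiftPerm, Equiv.coe_fn_mk, itinerary, zpow_add_one, Equiv.Perm.mul_apply]

theorem shiftPerm_pow_itinerary (x : X) (n : ℕ) :
    (shiftPerm ^ n) (itinerary T A x) = itinerary T A ((T ^ n) x) := by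
  induction n with
  | zero => simp
  | succ n ih => rw [pow_succ', Equiv.Perm.mul_apply, ih, shiftPerm_itinerary, ←
      Equiv.Perm.mul_apply, ← pow_succ']

theorem shiftPerm_zpow_itinerary (x : X) (n : ℤ) :
    (shiftPerm ^ n) (itinerary T A x) = itinerary T A ((T ^ n) x) := by
  obtain ⟨k, rfl | rfl⟩ := n.eq_nat_or_neg
  · simpa only [zpow_natCast] using shiftPerm_pow_itinerary x k
  · rw [zpow_neg, Equiv.Perm.inv_eq_iff_eq, zpow_natCast, shiftPerm_pow_itinerary,
      ← Equiv.Perm.mul_apply, zpow_neg, zpow_natCast, mul_inv_cancel, Equiv.Perm.one_apply]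

theorem itinerary_mem_divSet_iff (x : X) :
    itinerary T A x ∈ divSet shiftPerm {ω | ω 0} ↔ x ∈ divSet T A := by
  have : visitFreq shiftPerm {ω | ω 0} (itinerary T A x) = visitFreq T A x := by
    funext N
    simp only [visitFreq, shiftPerm_pow_itinerary]
    simp [itinerary]
  rw [divSet, divSet, Set.mem_ofPred_eq, Set.mem_ofPred_eq, this]

theorem measurable_itinerary [MeasurableSpace X] (hT : Measurable T) (hT' : Measurable T.symm)
    (hA : MeasurableSet A) : Measurable (itinerary T A) :=
  measurable_pi_lambda _ fun i => hA.mem.comp (measurable_perm_zpow hT hT' i)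

/-- In a standard Borel space, a countable family of measurable sets that separates points
generates the σ-algebra. -/
theorem generateFrom_eq_of_separating {Y : Type*} [m : MeasurableSpace Y] [StandardBorelSpace Y]
    {s : Set (Set Y)} (hs : s.Countable) (hm : ∀ t ∈ s, MeasurableSet t)
    (hsep : ∀ x y, (∀ t ∈ s, x ∈ t ↔ y ∈ t) → x = y) : MeasurableSpace.generateFrom s = m := by
  have hle : MeasurableSpace.generateFrom s ≤ m := MeasurableSpace.generateFrom_le hm
  have hc : @MeasurableSpace.CountablySeparated Y (MeasurableSpace.generateFrom s) :=
    @MeasurableSpace.CountablySeparated.mk Y (MeasurableSpace.generateFrom s)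
      ⟨s, hs, fun t ht => MeasurableSpace.measurableSet_generateFrom ht,
        fun x _ y _ h => hsep x y h⟩
  have h := @Measurable.map_measurableSpace_eq Y Y m _ (MeasurableSpace.generateFrom s) hc id
    (measurable_id'' hle) Function.surjective_id
  rw [← h]
  exact MeasurableSpace.map_id

/-- A set `C` whose visits, together with those to `A`, determine the points of `divSet T A`. -/
theorem exists_separating_set [MeasurableSpace X] [StandardBorelSpace X] (hT : Measurable T)
    (hT' : Measurable T.symm) (hA : MeasurableSet A) :
    ∃ C : Set X, MeasurableSet C ∧ ∀ x ∈ divSet T A, ∀ y,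
      (∀ n : ℤ, (T ^ n) x ∈ A ↔ (T ^ n) y ∈ A) → (∀ n : ℤ, (T ^ n) x ∈ C ↔ (T ^ n) y ∈ C) →
        x = y := by
  obtain ⟨R, hR, hex⟩ := exists_isCoding_divSet measurable_shiftPerm measurable_shiftPerm_symm
    (A := {ω : ℤ → Prop | ω 0}) (measurable_pi_apply 0).setOf
  let B := MeasurableSpace.natGeneratingSequence X
  let π := itinerary T A
  let C : Set X := {x | ∃ j d, π ((T ^ (-d : ℤ)) x) ∈ R j d ∧ (T ^ (-d : ℤ)) x ∈ B j}
  have hC : MeasurableSet C := by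
    refine (Measurable.exists fun j => Measurable.exists fun d : ℕ =>
      Measurable.comp (Measurable.and (p := fun x => π x ∈ R j d) ?_ ?_)
        (measurable_perm_zpow hT hT' (-d))).setOf
    · exact (hR.measurableSet j d).mem.comp (measurable_itinerary hT hT' hA)
    · exact (MeasurableSpace.measurableSet_natGeneratingSequence j).mem
  have hmem : ∀ x j d, π x ∈ R j d → (x ∈ B j ↔ (T ^ (d : ℤ)) x ∈ C) := by
    intro x j d hx
    constructor
    · intro hxB
      refine ⟨j, d, ?_⟩
      rw [← Equiv.Perm.mul_apply, ← zpow_add, neg_add_cancel, zpow_zero]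
      exact ⟨hx, hxB⟩
    · rintro ⟨j', d', h1, h2⟩
      set y := (T ^ (-d' : ℤ)) ((T ^ (d : ℤ)) x) with hy
      have hyx : (T ^ d') y = (T ^ d) x := by
        rw [hy, ← zpow_natCast, ← zpow_natCast, ← Equiv.Perm.mul_apply, ← zpow_add,
          add_neg_cancel, zpow_zero, Equiv.Perm.one_apply]
      have := hR.eq_of_eq h1 hx (by
        rw [shiftPerm_pow_itinerary, shiftPerm_pow_itinerary, hyx])
      obtain ⟨rfl, rfl⟩ := this
      rwa [← (T ^ d').injective hyx]
  refine ⟨C, hC, fun x hx y hxyA hxyC => ?_⟩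
  have hπ : π x = π y := funext fun n => propext (hxyA n)
  obtain ⟨n, hn⟩ := hex (π x) ((itinerary_mem_divSet_iff x).2 hx)
  refine (T ^ n).injective (MeasurableSpace.injective_mapNatBool X (funext fun j => ?_))
  obtain ⟨d, hd⟩ := hn j
  have hdx := hd
  rw [shiftPerm_zpow_itinerary] at hdx
  rw [hπ, shiftPerm_zpow_itinerary] at hd
  have := (hmem _ j d hdx).trans (Iff.trans ?_ (hmem _ j d hd).symm)
  · simpa [MeasurableSpace.mapNatBool] using this
  · simpa only [← Equiv.Perm.mul_apply, ← zpow_add] using hxyC (d + n)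

end Generator

/-- **Generator theorem for divergent points.** If `(X,𝓑,T)` is a Borel system and `A ∈ 𝓑`,
then the restriction of `T` to the `T`-invariant Borel set `div(A)` admits a 4-set
generator. -/
theorem div_has_four_set_generator {X : Type*} [MeasurableSpace X] [StandardBorelSpace X]
    (T : Equiv.Perm X) (hT : Measurable T) (hTinv : Measurable T.symm)
    (A : Set X) (hA : MeasurableSet A) :
    IsGeneratorOn T (divSet T A) 4 := by
  obtain ⟨C, hC, hsep⟩ := exists_separating_set hT hTinv hA
  have hY := measurableSet_divSet hT hA
  have : StandardBorelSpace (divSet T A) := hY.standardBorel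
  let c : X → Fin 4 := fun x =>
    if x ∈ A then (if x ∈ C then 0 else 1) else (if x ∈ C then 2 else 3)
  have hc : Measurable c :=
    Measurable.ite hA (Measurable.ite hC measurable_const measurable_const)
      (Measurable.ite hC measurable_const measurable_const)
  have hcA : ∀ x y, c x = c y → ((x ∈ A ↔ y ∈ A) ∧ (x ∈ C ↔ y ∈ C)) := fun x y => by
    by_cases h1 : x ∈ A <;> by_cases h2 : y ∈ A <;> by_cases h3 : x ∈ C <;> by_cases h4 : y ∈ C <;>
      simp [c, h1, h2, h3, h4]
  have himage : ∀ (n : ℤ) (s : Set X) (x : X), x ∈ ⇑(T ^ n) '' s ↔ (T ^ (-n)) x ∈ s := by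
    intro n s x
    rw [Equiv.image_eq_preimage_symm, Set.mem_preimage, zpow_neg]
    rfl
  refine ⟨fun i => divSet T A ∩ c ⁻¹' {i}, fun i => hY.inter (hc (measurableSet_singleton i)),
    fun i => Set.inter_subset_left, fun i j hij => ?_, ?_, ?_⟩
  · refine Set.disjoint_left.2 ?_
    rintro x ⟨_, rfl⟩ ⟨_, h⟩
    exact hij h
  · ext x
    simp
  · refine generateFrom_eq_of_separating ?_ ?_ fun x y h => Subtype.ext ?_
    · refine (Set.countable_range fun p : ℤ × Fin 4 =>
        (Subtype.val ⁻¹' (⇑(T ^ p.1) '' (divSet T A ∩ c ⁻¹' {p.2})) : Set (divSet T A))).mono ?_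
      rintro _ ⟨n, i, rfl⟩
      exact ⟨(n, i), rfl⟩
    · rintro _ ⟨n, i, rfl⟩
      refine measurable_subtype_coe ?_
      rw [show ⇑(T ^ n) '' (divSet T A ∩ c ⁻¹' {i}) =
        ⇑(T ^ (-n)) ⁻¹' (divSet T A ∩ c ⁻¹' {i}) from Set.ext fun x => himage n _ x]
      exact measurable_perm_zpow hT hTinv _ (hY.inter (hc (measurableSet_singleton i)))
    · have hcode : ∀ n : ℤ, c ((T ^ n) x) = c ((T ^ n) y) := fun n => by
        have := (h _ ⟨-n, c ((T ^ n) x), rfl⟩).1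
        simp only [Set.mem_preimage, himage, neg_neg] at this
        exact (this ⟨zpow_apply_mem_divSet x.2 n, rfl⟩).2.symm
      exact hsep x x.2 y (fun n => (hcA _ _ (hcode n)).1) fun n => (hcA _ _ (hcode n)).2
end

section
/- Let (X, 𝓑, T) be a Borel system and α = {A_i}_{i=1}^∞ a countable Borel partition of X. Then the restriction of T to the T-invariant Borel set def(α) admits a 16-set generator. -/
open Filter
open scoped Classical

/-- The set of `α`-deficient points for a countable partition `α = {A_i}_{i∈ℕ}`: the points `x`
such that `s(x,A_i)` exists and is positive for every `i`, and `∑_i s(x,A_i) < 1`. -/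
def defSet {X : Type*} (T : Equiv.Perm X) (α : ℕ → Set X) : Set X :=
  {x | ∃ L : ℕ → ℝ,
    (∀ i, 0 < L i ∧ Tendsto (visitFreq T (α i) x) atTop (nhds (L i))) ∧
    ∃ c : ℝ, HasSum L c ∧ c < 1}

section PermPowers

variable {Y : Type*}

lemma measurable_perm_zpow_s3 [MeasurableSpace Y] {T : Equiv.Perm Y} (hT : Measurable T)
    (hT' : Measurable T.symm) (n : ℤ) : Measurable (T ^ n : Equiv.Perm Y) := by
  cases n with
  | ofNat n =>
    simpa [Equiv.Perm.coe_pow] using hT.iterate n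
  | negSucc n =>
    have h : (T ^ (Int.negSucc n) : Equiv.Perm Y) = T.symm ^ (n + 1) := by
      rw [zpow_negSucc, ← inv_pow]; rfl
    rw [h, Equiv.Perm.coe_pow]
    exact hT'.iterate _

lemma measurable_perm_pow_s3 [MeasurableSpace Y] {T : Equiv.Perm Y} (hT : Measurable T) (n : ℕ) :
    Measurable (T ^ n : Equiv.Perm Y) := by
  rw [Equiv.Perm.coe_pow]
  exact hT.iterate _

lemma perm_zpow_zpow (T : Equiv.Perm Y) (i j : ℤ) (x : Y) :
    (T ^ i) ((T ^ j) x) = (T ^ (i + j)) x := by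
  rw [zpow_add, Equiv.Perm.mul_apply]

/-- Moving each point along its orbit by a measurable time is a measurable map. -/
lemma measurable_pow_time [MeasurableSpace Y] {T : Equiv.Perm Y} (hT : Measurable T) {t : Y → ℕ}
    (ht : Measurable t) : Measurable fun x => (T ^ t x) x := by
  intro U hU
  have h : (fun x => (T ^ t x) x) ⁻¹' U = ⋃ n : ℕ, t ⁻¹' {n} ∩ (T ^ n : Equiv.Perm Y) ⁻¹' U := by
    ext x; simp
  rw [h]
  exact MeasurableSet.iUnion fun n =>
    (ht (measurableSet_singleton n)).inter (measurable_perm_pow_s3 hT n hU)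

lemma measurable_nat_sInf [MeasurableSpace Y] {p : ℕ → Y → Prop}
    (hp : ∀ n, MeasurableSet {x | p n x}) : Measurable fun x => sInf {n | p n x} := by
  refine measurable_of_Iic fun n => ?_
  have h : (fun x => sInf {n | p n x}) ⁻¹' Set.Iic n
      = (⋃ k, {x | p k x ∧ k ≤ n}) ∪ ⋂ k, {x | p k x}ᶜ := by
    ext x
    simp only [Set.mem_preimage, Set.mem_Iic, Set.mem_union, Set.mem_iUnion, Set.mem_ofPred_eq,
      Set.mem_iInter, Set.mem_compl_iff]
    constructor
    · intro hx
      by_cases hne : {n | p n x}.Nonempty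
      · exact Or.inl ⟨_, Nat.sInf_mem hne, hx⟩
      · right
        intro k hk
        exact hne ⟨k, hk⟩
    · rintro (⟨k, hk, hkn⟩ | hx)
      · exact (Nat.sInf_le hk).trans hkn
      · have : {n | p n x} = ∅ := Set.eq_empty_of_forall_notMem hx
        simp [this]
  rw [h]
  refine (MeasurableSet.iUnion fun k => ?_).union (MeasurableSet.iInter fun k => (hp k).compl)
  exact (hp k).inter (MeasurableSet.const _)

end PermPowers

section Matching

variable {Y : Type*}

/-- The number of visits to `A` among the first `N` points of the forward orbit of `x`. -/
noncomputable def visitCount (T : Equiv.Perm Y) (A : Set Y) (x : Y) (N : ℕ) : ℕ :=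
  ∑ i ∈ Finset.range N, if (T ^ i) x ∈ A then 1 else 0

lemma visitFreq_eq (T : Equiv.Perm Y) (A : Set Y) (x : Y) (N : ℕ) :
    visitFreq T A x N = (visitCount T A x N : ℝ) / N := by
  simp [visitFreq, visitCount]

lemma visitCount_succ (T : Equiv.Perm Y) (A : Set Y) (x : Y) (N : ℕ) :
    visitCount T A x (N + 1) = visitCount T A x N + if (T ^ N) x ∈ A then 1 else 0 :=
  Finset.sum_range_succ _ _

lemma visitCount_add (T : Equiv.Perm Y) (A : Set Y) (x : Y) (M N : ℕ) :
    visitCount T A x (M + N) = visitCount T A x M + visitCount T A ((T ^ M) x) N := by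
  rw [visitCount, visitCount, visitCount, Finset.sum_range_add]
  congr 1
  refine Finset.sum_congr rfl fun i _ => ?_
  rw [add_comm, pow_add, Equiv.Perm.mul_apply]

lemma visitCount_add_compl (T : Equiv.Perm Y) (A : Set Y) (x : Y) (N : ℕ) :
    visitCount T A x N + visitCount T Aᶜ x N = N := by
  rw [visitCount, visitCount, ← Finset.sum_add_distrib]
  conv_rhs => rw [← Finset.card_range N, Finset.card_eq_sum_ones]
  refine Finset.sum_congr rfl fun i _ => ?_
  by_cases h : (T ^ i) x ∈ A <;> simp [h]

lemma measurable_visitCount [MeasurableSpace Y] {T : Equiv.Perm Y} (hT : Measurable T)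
    {A : Set Y} (hA : MeasurableSet A) (N : ℕ) : Measurable fun x => visitCount T A x N :=
  Finset.measurable_sum _ fun i _ =>
    Measurable.ite (measurable_perm_pow_s3 hT i hA) measurable_const measurable_const

/-- The time at which bracket matching sends a point of `D` to a later point of `E`. -/
noncomputable def matchTime (T : Equiv.Perm Y) (D E : Set Y) (x : Y) : ℕ :=
  sInf {N | 1 ≤ N ∧ visitCount T D x N ≤ visitCount T E (T x) N}

/-- Every point of `D` has a forward window in which `E` is visited at least as often. -/
def Matchable (T : Equiv.Perm Y) (D E : Set Y) : Prop :=
  ∀ x ∈ D, ∃ N, 1 ≤ N ∧ visitCount T D x N ≤ visitCount T E (T x) N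

variable {T : Equiv.Perm Y} {D E : Set Y}

lemma Matchable.matchTime_spec (h : Matchable T D E) {x : Y} (hx : x ∈ D) :
    1 ≤ matchTime T D E x ∧
      visitCount T D x (matchTime T D E x) ≤ visitCount T E (T x) (matchTime T D E x) :=
  Nat.sInf_mem (s := {N | 1 ≤ N ∧ visitCount T D x N ≤ visitCount T E (T x) N}) (h x hx)

lemma lt_of_lt_matchTime {x : Y} {N : ℕ} (h1 : 1 ≤ N) (hN : N < matchTime T D E x) :
    visitCount T E (T x) N < visitCount T D x N := by
  by_contra! hcon
  exact Nat.notMem_of_lt_sInf hN ⟨h1, hcon⟩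

/-- The image of a matched point lies in `E`, and at that moment the two counts agree. -/
lemma Matchable.mem_and_count_eq (h : Matchable T D E) {x : Y} (hx : x ∈ D) :
    (T ^ matchTime T D E x) x ∈ E ∧
      visitCount T D x (matchTime T D E x) = visitCount T E (T x) (matchTime T D E x) := by
  obtain ⟨h1, h2⟩ := h.matchTime_spec hx
  obtain ⟨M, hM⟩ : ∃ M, matchTime T D E x = M + 1 := ⟨_, (Nat.sub_add_cancel h1).symm⟩
  have hlt : M = 0 ∨ visitCount T E (T x) M < visitCount T D x M := by
    rcases Nat.eq_zero_or_pos M with h0 | h0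
    · exact Or.inl h0
    · exact Or.inr (lt_of_lt_matchTime h0 (by omega))
  have hpow : (T ^ M) (T x) = (T ^ (M + 1)) x := by rw [pow_succ, Equiv.Perm.mul_apply]
  rw [hM] at h2 ⊢
  rw [visitCount_succ, visitCount_succ, hpow] at h2 ⊢
  rcases hlt with rfl | hlt
  · by_cases hE : T x ∈ E <;> simp_all [visitCount]
  · by_cases hE : (T ^ (M + 1)) x ∈ E
    · simp only [hE, if_true, true_and] at h2 ⊢
      split_ifs at h2 ⊢ <;> omega
    · simp only [hE, if_false] at h2
      split_ifs at h2 <;> omega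

lemma Matchable.injOn (h : Matchable T D E) :
    Set.InjOn (fun x => (T ^ matchTime T D E x) x) D := by
  have key : ∀ x ∈ D, ∀ y ∈ D, matchTime T D E y ≤ matchTime T D E x →
      (T ^ matchTime T D E x) x = (T ^ matchTime T D E y) y → x = y := by
    intro x hx y hy hle heq
    obtain ⟨j, hj⟩ := Nat.exists_eq_add_of_le' hle
    have hxy : (T ^ j) x = y := by
      apply (T ^ matchTime T D E y).injective
      rw [← heq, ← Equiv.Perm.mul_apply, ← pow_add, hj, add_comm]
    rcases Nat.eq_zero_or_pos j with rfl | hpos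
    · simpa using hxy
    exfalso
    have hcx := (h.mem_and_count_eq hx).2
    have hcy := (h.mem_and_count_eq hy).2
    have hy1 := (h.matchTime_spec hy).1
    have hlt : visitCount T E (T x) j < visitCount T D x j :=
      lt_of_lt_matchTime hpos (by omega)
    have hT : (T ^ j) (T x) = T y := by
      rw [← hxy, ← Equiv.Perm.mul_apply, ← Equiv.Perm.mul_apply, pow_mul_comm']
    rw [hj, visitCount_add, visitCount_add, hT, hxy] at hcx
    omega
  intro x hx y hy heq
  rcases le_total (matchTime T D E y) (matchTime T D E x) with hle | hle
  · exact key x hx y hy hle heq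
  · exact (key y hy x hx hle heq.symm).symm

end Matching

section Compression

open scoped MeasureTheory

variable {Y : Type*}

/-- The index of the first set of the family `D` that contains `x`. -/
noncomputable def firstIndex (D : ℕ → Set Y) (x : Y) : ℕ := sInf {k | x ∈ D k}

/-- Match each point into `E k`, where `k` is the first index with `x ∈ D k`. -/
noncomputable def compression (T : Equiv.Perm Y) (D E : ℕ → Set Y) (x : Y) : Y :=
  (T ^ matchTime T (D (firstIndex D x)) (E (firstIndex D x)) x) x

lemma measurable_compression [MeasurableSpace Y] {T : Equiv.Perm Y} (hT : Measurable T)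
    {D E : ℕ → Set Y} (hD : ∀ k, MeasurableSet (D k)) (hE : ∀ k, MeasurableSet (E k)) :
    Measurable (compression T D E) := by
  have hidx : Measurable (firstIndex D) := measurable_nat_sInf hD
  refine measurable_pow_time hT (measurable_nat_sInf fun N => ?_)
  have h : {x | 1 ≤ N ∧ visitCount T (D (firstIndex D x)) x N
        ≤ visitCount T (E (firstIndex D x)) (T x) N}
      = ⋃ k, firstIndex D ⁻¹' {k} ∩
        {x | 1 ≤ N ∧ visitCount T (D k) x N ≤ visitCount T (E k) (T x) N} := by
    ext x; simp
  rw [h]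
  refine MeasurableSet.iUnion fun k => (hidx (measurableSet_singleton k)).inter ?_
  exact (MeasurableSet.const _).inter (measurableSet_le (measurable_visitCount hT (hD k) N)
    ((measurable_visitCount hT (hE k) N).comp hT))

variable {T : Equiv.Perm Y} {D E : ℕ → Set Y}

lemma mem_firstIndex (hcov : ∀ x, ∃ k, x ∈ D k) (x : Y) : x ∈ D (firstIndex D x) :=
  Nat.sInf_mem (s := {k | x ∈ D k}) (hcov x)

lemma compression_mem (hcov : ∀ x, ∃ k, x ∈ D k) (hm : ∀ k, Matchable T (D k) (E k)) (x : Y) :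
    compression T D E x ∈ E (firstIndex D x) :=
  ((hm _).mem_and_count_eq (mem_firstIndex hcov x)).1

lemma compression_injective (hcov : ∀ x, ∃ k, x ∈ D k) (hm : ∀ k, Matchable T (D k) (E k))
    (hE : Pairwise fun j k => Disjoint (E j) (E k)) : Function.Injective (compression T D E) := by
  intro x y hxy
  have hidx : firstIndex D x = firstIndex D y := by
    by_contra hne
    exact Set.disjoint_left.1 (hE hne) (compression_mem hcov hm x)
      (hxy ▸ compression_mem hcov hm y)
  refine (hm (firstIndex D x)).injOn (mem_firstIndex hcov x) (hidx ▸ mem_firstIndex hcov y) ?_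
  simp only [compression] at hxy
  rw [← hidx] at hxy
  exact hxy

/-- If an injection `f` avoids `F`, the sets `f^n(F)` are disjoint, so that a single set can
store, on `f^n(F)`, the trace on `F` of the `n`-th set of a sequence. -/
lemma inter_preimage_iUnion_image_iterate {f : Y → Y} (hf : Function.Injective f) {F : Set Y}
    (hF : ∀ x, f x ∉ F) (C : ℕ → Set Y) (n : ℕ) :
    F ∩ f^[n] ⁻¹' (⋃ j, f^[j] '' (F ∩ C j)) = F ∩ C n := by
  ext x
  simp only [Set.mem_inter_iff, Set.mem_preimage, Set.mem_iUnion, Set.mem_image]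
  constructor
  · rintro ⟨hx, j, y, ⟨hyF, hyC⟩, hy⟩
    refine ⟨hx, ?_⟩
    rcases lt_trichotomy n j with h | rfl | h
    · obtain ⟨i, rfl⟩ := Nat.exists_eq_add_of_lt h
      rw [add_assoc, Function.iterate_add_apply] at hy
      have := hf.iterate n hy
      rw [Function.iterate_succ_apply'] at this
      exact absurd (this ▸ hx) (hF _)
    · exact hf.iterate n hy ▸ hyC
    · obtain ⟨i, rfl⟩ := Nat.exists_eq_add_of_lt h
      rw [add_assoc, Function.iterate_add_apply] at hy
      have := hf.iterate j hy
      rw [Function.iterate_succ_apply'] at this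
      exact absurd (this ▸ hyF) (hF _)
  · rintro ⟨hx, hC⟩
    exact ⟨hx, n, x, ⟨hx, hC⟩, rfl⟩

/-- A σ-algebra invariant under `T` that contains the trace of every measurable set on a set `F`
visited by every orbit contains all measurable sets. -/
lemma le_of_trace_le [mY : MeasurableSpace Y] (hT' : Measurable T.symm)
    (m : MeasurableSpace Y) (hmT : Measurable[m, m] T) {F : Set Y}
    (hF : ∀ x, ∃ n : ℕ, (T ^ n) x ∈ F)
    (h : ∀ U, MeasurableSet[mY] U → MeasurableSet[m] (F ∩ U)) : mY ≤ m := by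
  intro U hU
  have hU' : U = ⋃ n : ℕ, (T ^ n : Equiv.Perm Y) ⁻¹' (F ∩ (T.symm ^ n : Equiv.Perm Y) ⁻¹' U) := by
    have hinv : ∀ (n : ℕ) (x : Y), (T.symm ^ n) ((T ^ n) x) = x := by
      intro n x
      change (T⁻¹ ^ n) ((T ^ n) x) = x
      rw [inv_pow, ← Equiv.Perm.mul_apply, inv_mul_cancel, Equiv.Perm.one_apply]
    ext x
    simp only [Set.preimage_inter, Set.mem_iUnion, Set.mem_inter_iff, Set.mem_preimage, hinv,
      exists_and_right]
    exact ⟨fun hx => ⟨hF x, hx⟩, fun hx => hx.2⟩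
  rw [hU']
  exact MeasurableSet.iUnion fun n =>
    @measurable_perm_pow_s3 Y m T hmT n _ (h _ (@measurable_perm_pow_s3 Y mY T.symm hT' n _ hU))

/-- A system with a compression into the complement of a complete section `F` has a set which,
together with the sets describing the compression, generates the σ-algebra. -/
theorem exists_generating_set [mY : MeasurableSpace Y] [StandardBorelSpace Y]
    (hT : Measurable T) (hT' : Measurable T.symm) {F : Set Y}
    (hD : ∀ k, MeasurableSet (D k)) (hE : ∀ k, MeasurableSet (E k)) (hFm : MeasurableSet F)
    (hcov : ∀ x, ∃ k, x ∈ D k) (hm : ∀ k, Matchable T (D k) (E k))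
    (hEd : Pairwise fun j k => Disjoint (E j) (E k)) (hEF : ∀ k, Disjoint (E k) F)
    (hF : ∀ x, ∃ n : ℕ, (T ^ n) x ∈ F) :
    ∃ e : Set Y, MeasurableSet e ∧ ∀ m : MeasurableSpace Y, Measurable[m, m] T →
      (∀ k, MeasurableSet[m] (D k)) → (∀ k, MeasurableSet[m] (E k)) → MeasurableSet[m] F →
      MeasurableSet[m] e → mY ≤ m := by
  have hinj := compression_injective hcov hm hEd
  have havoid : ∀ x, compression T D E x ∉ F := fun x =>
    Set.disjoint_left.1 (hEF _) (compression_mem hcov hm x)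
  let C := MeasurableSpace.natGeneratingSequence Y
  refine ⟨⋃ j, (compression T D E)^[j] '' (F ∩ C j), ?_, ?_⟩
  · refine MeasurableSet.iUnion fun j => ?_
    exact (hFm.inter (MeasurableSpace.measurableSet_natGeneratingSequence j)
      ).image_of_measurable_injOn ((measurable_compression hT hD hE).iterate j)
      (hinj.iterate j).injOn
  · intro m hmT hmD hmE hmF hme
    have hgen : ∀ n, MeasurableSet[m] (F ∩ C n) := fun n => by
      rw [← inter_preimage_iUnion_image_iterate hinj havoid C n]
      exact hmF.inter ((@measurable_compression Y m T hmT D E hmD hmE).iterate n hme)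
    refine @le_of_trace_le Y T mY hT' m hmT F hF fun U hU => ?_
    have hU' : MeasurableSet[MeasurableSpace.generateFrom (Set.range C)] U := by
      rw [MeasurableSpace.generateFrom_natGeneratingSequence]; exact hU
    induction U, hU' using MeasurableSpace.generateFrom_induction with
    | hC t ht _ =>
      obtain ⟨n, rfl⟩ := ht
      exact hgen n
    | empty => simp
    | compl t ht ih =>
      have h : F ∩ tᶜ = F \ (F ∩ t) := by ext; simp
      rw [h]
      refine hmF.diff (ih ?_)
      simpa using MeasurableSet.compl (m := mY) hU
    | iUnion f hf ih =>
      rw [Set.inter_iUnion]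
      refine MeasurableSet.iUnion fun n => ih n ?_
      have := hf n
      rwa [MeasurableSpace.generateFrom_natGeneratingSequence] at this

end Compression

section Markers

open scoped MeasureTheory

variable {Y : Type*}

/-- Every forward window of length `b` in every orbit meets `Z`. -/
def IsSyndetic (T : Equiv.Perm Y) (b : ℕ) (Z : Set Y) : Prop :=
  ∀ x, ∃ i : ℤ, 1 ≤ i ∧ i ≤ b ∧ (T ^ i) x ∈ Z

/-- Distinct visits of an orbit to `Z` are more than `L` steps apart. -/
def IsSeparatedBy (T : Equiv.Perm Y) (L : ℕ) (Z : Set Y) : Prop :=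
  ∀ x ∈ Z, ∀ i : ℤ, 1 ≤ i → i ≤ L → (T ^ i) x ∉ Z

lemma exists_separatedBy_cover [MeasurableSpace Y] [StandardBorelSpace Y] {T : Equiv.Perm Y}
    (hT : Measurable T) (hT' : Measurable T.symm)
    (haper : ∀ x, ∀ i : ℤ, 1 ≤ i → (T ^ i) x ≠ x) (L : ℕ) :
    ∃ V : ℕ → Set Y, (∀ n, MeasurableSet (V n)) ∧ (∀ n, IsSeparatedBy T L (V n)) ∧
      ∀ x, ∃ n, x ∈ V n := by
  obtain ⟨f, hf⟩ := MeasureTheory.exists_measurableEmbedding_real Y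
  obtain ⟨B, hBc, -, hB⟩ := TopologicalSpace.exists_countable_basis ℝ
  have hne : B.Nonempty := by
    obtain ⟨U, hU, -⟩ := hB.exists_subset_of_mem_open (Set.mem_univ (0 : ℝ)) isOpen_univ
    exact ⟨U, hU⟩
  obtain ⟨W, rfl⟩ := hBc.exists_eq_range hne
  refine ⟨fun n => f ⁻¹' W n ∩ ⋂ i ∈ Finset.Icc (1 : ℤ) L,
    (T ^ i : Equiv.Perm Y) ⁻¹' (f ⁻¹' W n)ᶜ, fun n => ?_, fun n x hx i h1 hi hxi => ?_,
    fun x => ?_⟩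
  · have hW : MeasurableSet (f ⁻¹' W n) :=
      hf.measurable (hB.isOpen (Set.mem_range_self n)).measurableSet
    exact hW.inter (Finset.measurableSet_biInter _ fun i _ =>
      measurable_perm_zpow_s3 hT hT' i hW.compl)
  · have := hx.2
    simp only [Set.mem_iInter] at this
    exact this i (Finset.mem_Icc.2 ⟨h1, hi⟩) hxi.1
  · have hfin : ((fun i : ℤ => f ((T ^ i) x)) '' Finset.Icc (1 : ℤ) L).Finite :=
      (Finset.finite_toSet _).image _
    obtain ⟨U, ⟨n, rfl⟩, hxU, hU⟩ := hB.exists_subset_of_mem_open (a := f x)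
      (u := ((fun i : ℤ => f ((T ^ i) x)) '' Finset.Icc (1 : ℤ) L)ᶜ)
      (by
        rintro ⟨i, hi, hfi⟩
        exact haper x i (Finset.mem_Icc.1 (Finset.mem_coe.1 hi)).1 (hf.injective hfi))
      hfin.isClosed.isOpen_compl
    refine ⟨n, hxU, ?_⟩
    simp only [Set.mem_iInter]
    intro i hi hmem
    exact hU hmem ⟨i, hi, rfl⟩

/-- Greedy union of separated sets: at each step add the points of `V n ∩ Z` that are far from
everything chosen before. -/
def greedySeparated (T : Equiv.Perm Y) (L : ℕ) (Z : Set Y) (V : ℕ → Set Y) : ℕ → Set Y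
  | 0 => ∅
  | n + 1 => greedySeparated T L Z V n ∪ (V n ∩ Z ∩
      ⋂ i ∈ Finset.Icc (-L : ℤ) L, (T ^ i : Equiv.Perm Y) ⁻¹' (greedySeparated T L Z V n)ᶜ)

lemma exists_maximal_separatedBy [MeasurableSpace Y] [StandardBorelSpace Y] {T : Equiv.Perm Y}
    (hT : Measurable T) (hT' : Measurable T.symm)
    (haper : ∀ x, ∀ i : ℤ, 1 ≤ i → (T ^ i) x ≠ x) (L : ℕ) {Z : Set Y} (hZ : MeasurableSet Z) :
    ∃ M ⊆ Z, MeasurableSet M ∧ IsSeparatedBy T L M ∧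
      ∀ x ∈ Z, ∃ i : ℤ, -L ≤ i ∧ i ≤ L ∧ (T ^ i) x ∈ M := by
  obtain ⟨V, hVm, hVs, hVc⟩ := exists_separatedBy_cover hT hT' haper L
  set G := greedySeparated T L Z V with hG
  have hsucc : ∀ n, G (n + 1) = G n ∪ (V n ∩ Z ∩
      ⋂ i ∈ Finset.Icc (-L : ℤ) L, (T ^ i : Equiv.Perm Y) ⁻¹' (G n)ᶜ) := fun n => rfl
  have hmono : Monotone G := monotone_nat_of_le_succ fun n => by
    rw [hsucc]; exact Set.subset_union_left
  have hmeas : ∀ n, MeasurableSet (G n) := by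
    intro n
    induction n with
    | zero => exact MeasurableSet.empty
    | succ n ih =>
      rw [hsucc]
      exact ih.union (((hVm n).inter hZ).inter (Finset.measurableSet_biInter _ fun i _ =>
        measurable_perm_zpow_s3 hT hT' i ih.compl))
  have hsub : ∀ n, G n ⊆ Z := by
    intro n
    induction n with
    | zero => exact Set.empty_subset _
    | succ n ih =>
      rw [hsucc]
      exact Set.union_subset ih fun x hx => hx.1.2
  have hsep : ∀ n, IsSeparatedBy T L (G n) := by
    intro n
    induction n with
    | zero => intro x hx; exact hx.elim
    | succ n ih =>
      intro x hx i h1 hi hxi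
      rw [hsucc] at hx hxi
      rcases hx with hx | hx <;> rcases hxi with hxi | hxi
      · exact ih x hx i h1 hi hxi
      · have := hxi.2
        simp only [Set.mem_iInter] at this
        refine this (-i) (Finset.mem_Icc.2 ⟨by omega, by omega⟩) ?_
        rw [perm_zpow_zpow, neg_add_cancel]
        exact hx
      · have := hx.2
        simp only [Set.mem_iInter] at this
        exact this i (Finset.mem_Icc.2 ⟨by omega, by omega⟩) hxi
      · exact hVs n x hx.1.1 i h1 hi hxi.1.1
  refine ⟨⋃ n, G n, Set.iUnion_subset hsub, MeasurableSet.iUnion hmeas, ?_, ?_⟩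
  · intro x hx i h1 hi hxi
    obtain ⟨n, hn⟩ := Set.mem_iUnion.1 hx
    obtain ⟨k, hk⟩ := Set.mem_iUnion.1 hxi
    exact hsep (max n k) x (hmono (le_max_left _ _) hn) i h1 hi (hmono (le_max_right _ _) hk)
  · intro x hx
    obtain ⟨n, hn⟩ := hVc x
    by_cases hfar : ∃ i : ℤ, -L ≤ i ∧ i ≤ L ∧ (T ^ i) x ∈ G n
    · obtain ⟨i, h1, h2, h3⟩ := hfar
      exact ⟨i, h1, h2, Set.mem_iUnion.2 ⟨n, h3⟩⟩
    · refine ⟨0, by omega, by omega, Set.mem_iUnion.2 ⟨n + 1, ?_⟩⟩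
      rw [hsucc]
      refine Or.inr ⟨⟨hn, hx⟩, ?_⟩
      simp only [Set.mem_iInter]
      intro i hi hmem
      exact hfar ⟨i, (Finset.mem_Icc.1 hi).1, (Finset.mem_Icc.1 hi).2, by simpa using hmem⟩

/-- A decreasing sequence of marker sets in which each marker set is syndetic, and is sparse
relative to the gaps of the previous one. -/
lemma exists_marker_hierarchy [MeasurableSpace Y] [StandardBorelSpace Y] {T : Equiv.Perm Y}
    (hT : Measurable T) (hT' : Measurable T.symm)
    (haper : ∀ x, ∀ i : ℤ, 1 ≤ i → (T ^ i) x ≠ x) :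
    ∃ (M : ℕ → Set Y) (b : ℕ → ℕ), (∀ k, MeasurableSet (M k)) ∧ M 0 = Set.univ ∧
      (∀ k, M (k + 1) ⊆ M k) ∧ (∀ k, IsSyndetic T (b k) (M k)) ∧
      ∀ k, IsSeparatedBy T (2 * b k + k) (M (k + 1)) := by
  have step : ∀ (k : ℕ) (p : {p : Set Y × ℕ // MeasurableSet p.1 ∧ IsSyndetic T p.2 p.1}),
      ∃ q : {p : Set Y × ℕ // MeasurableSet p.1 ∧ IsSyndetic T p.2 p.1},
        q.1.1 ⊆ p.1.1 ∧ IsSeparatedBy T (2 * p.1.2 + k) q.1.1 := by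
    rintro k ⟨⟨Z, b⟩, hZ, hb⟩
    obtain ⟨M, hMZ, hMm, hMs, hM⟩ :=
      exists_maximal_separatedBy hT hT' haper (2 * b + k) hZ
    refine ⟨⟨(M, 2 * (2 * b + k) + b), hMm, fun x => ?_⟩, hMZ, hMs⟩
    obtain ⟨i, h1, h2, h3⟩ := hb ((T ^ ((2 * b + k : ℕ) : ℤ)) x)
    rw [perm_zpow_zpow] at h3
    obtain ⟨j, h4, h5, h6⟩ := hM _ h3
    rw [perm_zpow_zpow] at h6
    refine ⟨_, ?_, ?_, h6⟩ <;> push_cast at * <;> omega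
  choose next hsub hsep using step
  let S : ℕ → {p : Set Y × ℕ // MeasurableSet p.1 ∧ IsSyndetic T p.2 p.1} := fun k =>
    Nat.rec ⟨(Set.univ, 1), MeasurableSet.univ, fun x => ⟨1, le_rfl, by simp, trivial⟩⟩ next k
  exact ⟨fun k => (S k).1.1, fun k => (S k).1.2, fun k => (S k).2.1, rfl,
    fun k => hsub k (S k), fun k => (S k).2.2, fun k => hsep k (S k)⟩

/-- The first visit to `Z` after `x` happens at time `i`. -/
def IsNextVisit (T : Equiv.Perm Y) (Z : Set Y) (x : Y) (i : ℤ) : Prop :=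
  1 ≤ i ∧ (T ^ i) x ∈ Z ∧ ∀ l : ℤ, 1 ≤ l → l < i → (T ^ l) x ∉ Z

variable {T : Equiv.Perm Y} {Z : Set Y}

lemma measurableSet_isNextVisit [MeasurableSpace Y] (hT : Measurable T)
    (hT' : Measurable T.symm) (hZ : MeasurableSet Z) (i : ℤ) :
    MeasurableSet {x | IsNextVisit T Z x i} := by
  refine (MeasurableSet.const _).inter ((measurable_perm_zpow_s3 hT hT' i hZ).inter ?_)
  change MeasurableSet {x | ∀ l : ℤ, 1 ≤ l → l < i → (T ^ l) x ∉ Z}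
  simp only [Set.ofPred_forall]
  exact MeasurableSet.iInter fun l => MeasurableSet.iInter fun _ => MeasurableSet.iInter fun _ =>
    (measurable_perm_zpow_s3 hT hT' l hZ).compl

lemma exists_isNextVisit {x : Y} (h : ∃ i : ℤ, 1 ≤ i ∧ (T ^ i) x ∈ Z) :
    ∃ i, IsNextVisit T Z x i := by
  obtain ⟨j, ⟨hj1, hj⟩, hjl⟩ := Int.exists_least_of_bdd
    (P := fun i : ℤ => 1 ≤ i ∧ (T ^ i) x ∈ Z) ⟨1, fun z hz => hz.1⟩ h
  exact ⟨j, hj1, hj, fun l hl1 hlj hl => absurd (hjl l ⟨hl1, hl⟩) (by omega)⟩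

lemma IsNextVisit.le {x : Y} {i j : ℤ} (hi : IsNextVisit T Z x i) (h1 : 1 ≤ j)
    (hj : (T ^ j) x ∈ Z) : i ≤ j := by
  by_contra! hcon
  exact hi.2.2 j h1 hcon hj

lemma IsNextVisit.injective {x y : Y} {i j : ℤ} (hx : x ∈ Z) (hy : y ∈ Z)
    (hi : IsNextVisit T Z x i) (hj : IsNextVisit T Z y j) (h : (T ^ i) x = (T ^ j) y) :
    x = y := by
  have hxy : x = (T ^ (j - i)) y := by
    apply (T ^ i).injective
    rw [h, perm_zpow_zpow, add_sub_cancel]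
  have hyx : y = (T ^ (i - j)) x := by
    rw [hxy, perm_zpow_zpow]; simp
  rcases lt_trichotomy i j with hij | rfl | hij
  · exact absurd (hxy ▸ hx) (hj.2.2 (j - i) (by omega) (by have := hi.1; omega))
  · simpa using hxy
  · exact absurd (hyx ▸ hy) (hi.2.2 (i - j) (by omega) (by have := hj.1; omega))

/-- The set marking, for each `k`, the `Z k`-successors of the points of `Z (k + 1)`. -/
def markerCode (T : Equiv.Perm Y) (Z : ℕ → Set Y) : Set Y :=
  {x | ∃ (k : ℕ) (i : ℤ), (T ^ (-i)) x ∈ Z (k + 1) ∧ IsNextVisit T (Z k) ((T ^ (-i)) x) i}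

lemma measurableSet_markerCode [MeasurableSpace Y] (hT : Measurable T) (hT' : Measurable T.symm)
    {Z : ℕ → Set Y} (hZ : ∀ k, MeasurableSet (Z k)) : MeasurableSet (markerCode T Z) := by
  simp only [markerCode, Set.ofPred_exists]
  exact MeasurableSet.iUnion fun k => MeasurableSet.iUnion fun i =>
    measurable_perm_zpow_s3 hT hT' (-i)
      ((hZ (k + 1)).inter (measurableSet_isNextVisit hT hT' (hZ k) i))

lemma mem_markerCode {Z : ℕ → Set Y} {x : Y} {k : ℕ} {i : ℤ} (hx : x ∈ Z (k + 1))
    (hi : IsNextVisit T (Z k) x i) : (T ^ i) x ∈ markerCode T Z := by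
  refine ⟨k, i, ?_⟩
  rw [perm_zpow_zpow, neg_add_cancel]
  exact ⟨hx, hi⟩

/-- Consecutive points of `Z (k + 1)` are separated by at least two other points of `Z k`. -/
def IsSparseHierarchy (T : Equiv.Perm Y) (Z : ℕ → Set Y) : Prop :=
  ∀ k x i j, x ∈ Z (k + 1) → IsNextVisit T (Z k) x i → IsNextVisit T (Z k) ((T ^ i) x) j →
    (T ^ i) x ∉ Z (k + 1) ∧ (T ^ j) ((T ^ i) x) ∉ Z (k + 1)

lemma mem_of_mem_markerCode {Z : ℕ → Set Y} (hanti : Antitone Z)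
    (hnext : ∀ k x, ∃ i, IsNextVisit T (Z k) x i) (hsp : IsSparseHierarchy T Z) {k : ℕ} {x : Y}
    {i : ℤ} (hx : x ∈ Z k) (hi : IsNextVisit T (Z k) x i) (hnot : (T ^ i) x ∉ Z (k + 1))
    (hc : (T ^ i) x ∈ markerCode T Z) : x ∈ Z (k + 1) := by
  obtain ⟨m, j, hw, hj⟩ := hc
  set w := (T ^ (-j)) ((T ^ i) x) with hwdef
  have hjw : (T ^ j) w = (T ^ i) x := by
    rw [hwdef, perm_zpow_zpow, add_neg_cancel]; simp
  obtain ⟨l, hl⟩ := hnext m ((T ^ j) w)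
  have hmk : m = k := by
    rcases lt_trichotomy m k with h | h | h
    · exact absurd (hanti h (hjw ▸ hi.2.1)) (hsp m w j l hw hj hl).1
    · exact h
    · exact absurd (hanti h (hjw ▸ hj.2.1)) hnot
  subst hmk
  rw [IsNextVisit.injective hx (hanti (Nat.le_succ m) hw) hi hj hjw.symm]
  exact hw

/-- The marker code determines `Z (k + 1)` from `Z k`. -/
lemma marker_succ_eq {Z : ℕ → Set Y} (hanti : Antitone Z)
    (hnext : ∀ k x, ∃ i, IsNextVisit T (Z k) x i) (hsp : IsSparseHierarchy T Z) (k : ℕ) :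
    Z (k + 1) = Z k ∩ ⋃ (i : ℤ) (j : ℤ), {x | IsNextVisit T (Z k) x i} ∩
      (T ^ i : Equiv.Perm Y) ⁻¹' ({y | IsNextVisit T (Z k) y j} ∩ markerCode T Z ∩
        (T ^ j : Equiv.Perm Y) ⁻¹' (markerCode T Z)ᶜ) := by
  ext x
  simp only [Set.mem_inter_iff, Set.mem_iUnion, Set.mem_preimage, Set.mem_ofPred_eq,
    Set.mem_compl_iff]
  constructor
  · intro hx
    obtain ⟨i, hi⟩ := hnext k x
    obtain ⟨j, hj⟩ := hnext k ((T ^ i) x)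
    have hs := hsp k x i j hx hi hj
    exact ⟨hanti (Nat.le_succ k) hx, i, j, hi, ⟨hj, mem_markerCode hx hi⟩, fun hc =>
      hs.1 (mem_of_mem_markerCode hanti hnext hsp hi.2.1 hj hs.2 hc)⟩
  · rintro ⟨hx, i, j, hi, ⟨hj, hc⟩, hc'⟩
    refine mem_of_mem_markerCode hanti hnext hsp hx hi (fun hmem => ?_) hc
    exact hc' (mem_markerCode hmem hj)

/-- An invariant σ-algebra containing the marker code contains the whole hierarchy. -/
lemma measurableSet_of_markerCode {Z : ℕ → Set Y} (hanti : Antitone Z) (h0 : Z 0 = Set.univ)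
    (hnext : ∀ k x, ∃ i, IsNextVisit T (Z k) x i) (hsp : IsSparseHierarchy T Z)
    [MeasurableSpace Y] (hT : Measurable T) (hT' : Measurable T.symm)
    (hc : MeasurableSet (markerCode T Z)) (k : ℕ) : MeasurableSet (Z k) := by
  induction k with
  | zero => rw [h0]; exact MeasurableSet.univ
  | succ k ih =>
    rw [marker_succ_eq hanti hnext hsp k]
    refine ih.inter (MeasurableSet.iUnion fun i => MeasurableSet.iUnion fun j => ?_)
    exact (measurableSet_isNextVisit hT hT' ih i).inter (measurable_perm_zpow_s3 hT hT' i
      (((measurableSet_isNextVisit hT hT' ih j).inter hc).inter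
        (measurable_perm_zpow_s3 hT hT' j hc.compl)))

end Markers

section InvariantFunctions

variable {Y : Type*} {T : Equiv.Perm Y}

lemma apply_zpow_of_invariant {β : Type*} {f : Y → β} (hf : ∀ x, f (T x) = f x) (n : ℤ) (x : Y) :
    f ((T ^ n) x) = f x := by
  have hnat : ∀ (n : ℕ) (x : Y), f ((T ^ n) x) = f x := by
    intro n
    induction n with
    | zero => intro x; simp
    | succ n ih => intro x; rw [pow_succ, Equiv.Perm.mul_apply, ih, hf]
  cases n with
  | ofNat n => exact hnat n x
  | negSucc n =>
    have h := hnat (n + 1) ((T ^ Int.negSucc n) x)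
    rw [← zpow_natCast, perm_zpow_zpow] at h
    have h0 : ((n + 1 : ℕ) : ℤ) + Int.negSucc n = 0 := by omega
    rw [h0, zpow_zero, Equiv.Perm.one_apply] at h
    exact h.symm

/-- A marker hierarchy whose first nontrivial level is as sparse as prescribed by an invariant
function `K`. -/
lemma exists_adapted_hierarchy [MeasurableSpace Y] [StandardBorelSpace Y]
    (hT : Measurable T) (hT' : Measurable T.symm)
    (haper : ∀ x, ∀ i : ℤ, 1 ≤ i → (T ^ i) x ≠ x) {K : Y → ℕ} (hK : Measurable K)
    (hKT : ∀ x, K (T x) = K x) :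
    ∃ (Z : ℕ → Set Y) (B : ℕ → Y → ℕ), (∀ k, MeasurableSet (Z k)) ∧ Antitone Z ∧
      Z 0 = Set.univ ∧ (∀ k x, ∃ i, IsNextVisit T (Z k) x i) ∧ IsSparseHierarchy T Z ∧
      (∀ k, Measurable (B k)) ∧ (∀ k x, B k (T x) = B k x) ∧
      (∀ k x, ∃ i : ℤ, 1 ≤ i ∧ i ≤ B k x ∧ (T ^ i) x ∈ Z k \ Z (k + 1)) ∧
      ∀ x ∈ Z 1, ∀ i : ℤ, 1 ≤ i → i ≤ K x → (T ^ i) x ∉ Z 1 := by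
  obtain ⟨M, b, hMm, hM0, hMs, hMb, hMsep⟩ := exists_marker_hierarchy hT hT' haper
  have hMa : Antitone M := antitone_nat_of_succ_le hMs
  have hKz := apply_zpow_of_invariant hKT
  let lev : Y → ℕ → ℕ := fun x k => if k = 0 then 0 else K x + k
  have hlev : ∀ x k, lev x k ≤ K x + k := by
    intro x k
    simp only [lev]
    split_ifs <;> omega
  let Z : ℕ → Set Y := fun k => {x | x ∈ M (lev x k)}
  have hZsucc : ∀ k x, x ∈ Z (k + 1) ↔ x ∈ M (K x + k + 1) := fun k x => Iff.rfl
  have hZsyn : ∀ k x, ∃ i : ℤ, 1 ≤ i ∧ i ≤ b (K x + k) ∧ (T ^ i) x ∈ Z k := by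
    intro k x
    obtain ⟨i, h1, h2, h3⟩ := hMb (K x + k) x
    refine ⟨i, h1, h2, hMa (hlev _ k) ?_⟩
    rwa [hKz]
  have hnext : ∀ k x, ∃ i, IsNextVisit T (Z k) x i := by
    intro k x
    obtain ⟨i, h1, h2, h3⟩ := hZsyn k x
    exact exists_isNextVisit ⟨i, h1, h3⟩
  have hle : ∀ k x i, IsNextVisit T (Z k) x i → i ≤ b (K x + k) := by
    intro k x i hi
    obtain ⟨j, h1, h2, h3⟩ := hZsyn k x
    exact (hi.le h1 h3).trans h2
  have hsp : IsSparseHierarchy T Z := by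
    intro k x i j hx hi hj
    have hi' := hle k x i hi
    have hj' := hle k _ j hj
    rw [hKz] at hj'
    have hi1 := hi.1
    have hj1 := hj.1
    have key := hMsep (K x + k) x hx
    constructor
    · rw [hZsucc, hKz]
      exact key i hi1 (by push_cast; omega)
    · rw [hZsucc, hKz, hKz, perm_zpow_zpow]
      exact key (j + i) (by omega) (by push_cast; omega)
  refine ⟨Z, fun k x => 2 * b (K x + k), fun k => ?_, antitone_nat_of_succ_le fun k x hx => ?_,
    ?_, hnext, hsp, fun k => ?_, fun k x => ?_, fun k x => ?_, fun x hx i h1 hi => ?_⟩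
  · have h : Z k = ⋃ n, K ⁻¹' {n} ∩ M (if k = 0 then 0 else n + k) := by
      ext x
      simp [Z, lev]
    rw [h]
    exact MeasurableSet.iUnion fun n => (hK (measurableSet_singleton n)).inter (hMm _)
  · exact hMa ((hlev x k).trans (Nat.le_succ _)) ((hZsucc k x).1 hx)
  · ext x
    simp [Z, lev, hM0]
  · exact (measurable_from_top (f := fun n => 2 * b (n + k))).comp hK
  · simp only [hKT]
  · obtain ⟨i, hi⟩ := hnext k x
    obtain ⟨j, hj⟩ := hnext k ((T ^ i) x)
    have hi' := hle k x i hi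
    have hj' := hle k _ j hj
    rw [hKz] at hj'
    have hi1 := hi.1
    have hj1 := hj.1
    by_cases hmem : (T ^ i) x ∈ Z (k + 1)
    · obtain ⟨l, hl⟩ := hnext k ((T ^ j) ((T ^ i) x))
      have := (hsp k _ j l hmem hj hl).1
      refine ⟨j + i, by omega, by push_cast; omega, ?_⟩
      rw [← perm_zpow_zpow]
      exact ⟨hj.2.1, this⟩
    · exact ⟨i, hi1, by push_cast; omega, hi.2.1, hmem⟩
  · rw [hZsucc, hKz]
    exact hMsep (K x) x hx i h1 (by push_cast; omega)

end InvariantFunctions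

section Densities

variable {Y : Type*} {T : Equiv.Perm Y}

lemma le_visitCount_of_syndetic {Z : Set Y} {b : ℕ} (x : Y)
    (h : ∀ n : ℕ, ∃ i : ℤ, 1 ≤ i ∧ i ≤ b ∧ (T ^ i) ((T ^ n) x) ∈ Z) (m : ℕ) :
    m ≤ visitCount T Z (T x) (b * m) := by
  have hstep : ∀ n : ℕ, 1 ≤ visitCount T Z (T ((T ^ n) x)) b := by
    intro n
    obtain ⟨i, h1, h2, h3⟩ := h n
    obtain ⟨j, rfl⟩ : ∃ j : ℕ, i = j + 1 := ⟨(i - 1).toNat, by omega⟩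
    have hj : (T ^ j) (T ((T ^ n) x)) ∈ Z := by
      rw [← zpow_natCast]
      rw [zpow_add, zpow_one, Equiv.Perm.mul_apply] at h3
      exact h3
    calc 1 = (if (T ^ j) (T ((T ^ n) x)) ∈ Z then 1 else 0) := by rw [if_pos hj]
      _ ≤ visitCount T Z (T ((T ^ n) x)) b :=
        Finset.single_le_sum (f := fun j => if (T ^ j) (T ((T ^ n) x)) ∈ Z then 1 else 0)
          (fun _ _ => Nat.zero_le _) (Finset.mem_range.2 (by omega))
  induction m with
  | zero => exact Nat.zero_le _
  | succ m ih =>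
    rw [Nat.mul_succ, visitCount_add]
    have hcomm : (T ^ (b * m)) (T x) = T ((T ^ (b * m)) x) := by
      rw [← Equiv.Perm.mul_apply, ← Equiv.Perm.mul_apply, pow_mul_comm']
    rw [hcomm]
    exact Nat.add_le_add ih (hstep _)

lemma visitCount_le_of_separated {Z : Set Y} {L : ℕ} (x : Y)
    (h : ∀ n : ℕ, (T ^ n) x ∈ Z → ∀ i : ℤ, 1 ≤ i → i ≤ L → (T ^ i) ((T ^ n) x) ∉ Z) (m : ℕ) :
    visitCount T Z x ((L + 1) * m) ≤ m := by
  have hstep : ∀ n : ℕ, visitCount T Z ((T ^ n) x) (L + 1) ≤ 1 := by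
    intro n
    rw [visitCount, ← Finset.card_filter, Finset.card_le_one]
    have key : ∀ p q : ℕ, p < q → q < L + 1 → (T ^ p) ((T ^ n) x) ∈ Z →
        (T ^ q) ((T ^ n) x) ∉ Z := by
      intro p q hpq hq hp
      rw [← Equiv.Perm.mul_apply, ← pow_add] at hp
      have := h (p + n) hp (q - p) (by omega) (by omega)
      rwa [← zpow_natCast, perm_zpow_zpow, show ((q : ℤ) - p + (p + n : ℕ)) = ((q + n : ℕ) : ℤ) by
        push_cast; ring, zpow_natCast, pow_add, Equiv.Perm.mul_apply] at this
    intro p hp q hq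
    rw [Finset.mem_filter, Finset.mem_range] at hp hq
    rcases lt_trichotomy p q with hpq | hpq | hpq
    · exact absurd hq.2 (key p q hpq hq.1 hp.2)
    · exact hpq
    · exact absurd hp.2 (key q p hpq hp.1 hq.2)
  induction m with
  | zero => simp [visitCount]
  | succ m ih =>
    rw [Nat.mul_succ, visitCount_add]
    exact Nat.add_le_add ih (hstep _)

lemma visitCount_le_sum {ι : Type*} (J : Finset ι) (A : Set Y) (C : ι → Set Y) (x : Y)
    (y : ι → Y) (h : ∀ n : ℕ, (T ^ n) x ∈ A → ∃ i ∈ J, (T ^ n) (y i) ∈ C i) (N : ℕ) :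
    visitCount T A x N ≤ ∑ i ∈ J, visitCount T (C i) (y i) N := by
  simp only [visitCount]
  rw [Finset.sum_comm]
  refine Finset.sum_le_sum fun n _ => ?_
  by_cases hn : (T ^ n) x ∈ A
  · obtain ⟨i, hi, hC⟩ := h n hn
    rw [if_pos hn]
    calc 1 = (if (T ^ n) (y i) ∈ C i then 1 else 0) := by rw [if_pos hC]
      _ ≤ _ := Finset.single_le_sum (f := fun i => if (T ^ n) (y i) ∈ C i then 1 else 0)
          (fun _ _ => Nat.zero_le _) hi
  · rw [if_neg hn]
    exact Nat.zero_le _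

/-- If `A` is covered along the orbit of `x` by finitely many sets with visit frequencies, of total
less than `q`, then some window whose length is a multiple of `b` has few visits to `A`. -/
lemma exists_window_visitCount_lt {ι : Type*} (J : Finset ι) (A : Set Y) (C : ι → Set Y) (x : Y)
    (y : ι → Y) (h : ∀ n : ℕ, (T ^ n) x ∈ A → ∃ i ∈ J, (T ^ n) (y i) ∈ C i) {s : ι → ℝ}
    (hs : ∀ i ∈ J, Tendsto (visitFreq T (C i) (y i)) atTop (nhds (s i))) {q : ℝ}
    (hq : ∑ i ∈ J, s i < q) {b : ℕ} (hb : 1 ≤ b) :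
    ∃ m : ℕ, 1 ≤ m ∧ (visitCount T A x (b * m) : ℝ) < q * (b * m) := by
  have hlim : Tendsto (fun m : ℕ => ∑ i ∈ J, visitFreq T (C i) (y i) (b * m)) atTop
      (nhds (∑ i ∈ J, s i)) :=
    (tendsto_finsetSum J hs).comp (tendsto_id.const_mul_atTop' hb)
  obtain ⟨m, hm, hm1⟩ := ((hlim.eventually_lt_const hq).and (eventually_ge_atTop 1)).exists
  refine ⟨m, hm1, ?_⟩
  have hpos : (0 : ℝ) < b * m := by positivity
  rw [← div_lt_iff₀ hpos]
  refine lt_of_le_of_lt ?_ hm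
  have hcount : (visitCount T A x (b * m) : ℝ)
      ≤ ∑ i ∈ J, (visitCount T (C i) (y i) (b * m) : ℝ) := by
    exact_mod_cast visitCount_le_sum J A C x y h (b * m)
  simp only [visitFreq_eq]
  rw [← Finset.sum_div]
  push_cast
  gcongr

end Densities

section Coding

open scoped MeasureTheory

variable {Y : Type*} {T : Equiv.Perm Y}

/-- The set recording, on the disjoint sets `P k`, which points have a point of `A k` among their
last `B k` predecessors. -/
def storeCode (T : Equiv.Perm Y) (P A : ℕ → Set Y) (B : ℕ → Y → ℕ) : Set Y :=
  {p | ∃ k, p ∈ P k ∧ ∃ j : ℤ, 1 ≤ j ∧ j ≤ B k p ∧ (T ^ (-j)) p ∈ A k}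

lemma measurableSet_storeCode [MeasurableSpace Y] (hT : Measurable T) (hT' : Measurable T.symm)
    {P A : ℕ → Set Y} {B : ℕ → Y → ℕ} (hP : ∀ k, MeasurableSet (P k))
    (hA : ∀ k, MeasurableSet (A k)) (hB : ∀ k, Measurable (B k)) :
    MeasurableSet (storeCode T P A B) := by
  have h : storeCode T P A B = ⋃ k, P k ∩ ⋃ j : ℤ, {p | 1 ≤ j ∧ j ≤ B k p} ∩
      (T ^ (-j) : Equiv.Perm Y) ⁻¹' A k := by
    ext p
    simp [storeCode, and_assoc]
  rw [h]
  refine MeasurableSet.iUnion fun k => (hP k).inter (MeasurableSet.iUnion fun j => ?_)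
  refine MeasurableSet.inter ((MeasurableSet.const _).inter ?_)
    (measurable_perm_zpow_s3 hT hT' (-j) (hA k))
  exact measurableSet_le measurable_const
    ((measurable_from_top (f := fun n : ℕ => (n : ℤ))).comp (hB k))

/-- The points whose next visit to `P` lies in `b`. -/
def nextVisitIn (T : Equiv.Perm Y) (P b : Set Y) : Set Y :=
  {x | ∃ i, IsNextVisit T P x i ∧ (T ^ i) x ∈ b}

lemma measurableSet_nextVisitIn [MeasurableSpace Y] (hT : Measurable T)
    (hT' : Measurable T.symm) {P b : Set Y} (hP : MeasurableSet P) (hb : MeasurableSet b) :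
    MeasurableSet (nextVisitIn T P b) := by
  simp only [nextVisitIn, Set.ofPred_exists]
  exact MeasurableSet.iUnion fun i =>
    (measurableSet_isNextVisit hT hT' hP i).inter (measurable_perm_zpow_s3 hT hT' i hb)

variable {P A : ℕ → Set Y} {B : ℕ → Y → ℕ}

lemma mem_nextVisitIn_storeCode (hBT : ∀ k x, B k (T x) = B k x) {k : ℕ} {x : Y}
    (hx : x ∈ A k) (hP : ∃ i : ℤ, 1 ≤ i ∧ i ≤ B k x ∧ (T ^ i) x ∈ P k) :
    x ∈ nextVisitIn T (P k) (storeCode T P A B) := by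
  obtain ⟨j, hj1, hjB, hj⟩ := hP
  obtain ⟨i, hi⟩ := exists_isNextVisit ⟨j, hj1, hj⟩
  refine ⟨i, hi, k, hi.2.1, i, hi.1, ?_, ?_⟩
  · rw [apply_zpow_of_invariant (hBT k)]
    exact (hi.le hj1 hj).trans hjB
  · rw [perm_zpow_zpow, neg_add_cancel]
    simpa using hx

lemma exists_mem_of_mem_nextVisitIn_storeCode (hBT : ∀ k x, B k (T x) = B k x)
    (hPd : Pairwise fun j k => Disjoint (P j) (P k)) {k : ℕ} {x : Y}
    (hP : ∃ i : ℤ, 1 ≤ i ∧ i ≤ B k x ∧ (T ^ i) x ∈ P k)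
    (hx : x ∈ nextVisitIn T (P k) (storeCode T P A B)) :
    ∃ l ∈ Finset.Ioo (-(B k x) : ℤ) (B k x), (T ^ l) x ∈ A k := by
  obtain ⟨j, hj1, hjB, hj⟩ := hP
  obtain ⟨i, hi, k', hk', l, hl1, hlB, hl⟩ := hx
  obtain rfl : k' = k := by
    by_contra hne
    exact Set.disjoint_left.1 (hPd hne) hk' hi.2.1
  rw [apply_zpow_of_invariant (hBT k')] at hlB
  rw [perm_zpow_zpow] at hl
  have := hi.le hj1 hj
  have := hi.1
  exact ⟨-l + i, Finset.mem_Ioo.2 ⟨by omega, by omega⟩, hl⟩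

/-- A system in which every point is deficient for the partition into the level sets of `label` is
generated by four sets. -/
theorem exists_four_generating_sets [mY : MeasurableSpace Y] [StandardBorelSpace Y]
    (hT : Measurable T) (hT' : Measurable T.symm)
    (haper : ∀ x, ∀ i : ℤ, 1 ≤ i → (T ^ i) x ≠ x) {label : Y → ℕ} (hlabel : Measurable label)
    {s : ℕ → Y → ℝ} {S : Y → ℝ} (hsm : ∀ i, Measurable (s i)) (hSm : Measurable S)
    (hsT : ∀ i x, s i (T x) = s i x) (hST : ∀ x, S (T x) = S x) (hs0 : ∀ i x, 0 ≤ s i x)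
    (hsum : ∀ x, HasSum (fun i => s i x) (S x)) (hS1 : ∀ x, S x < 1)
    (hfreq : ∀ i x, Tendsto (visitFreq T (label ⁻¹' {i}) x) atTop (nhds (s i x))) :
    ∃ a b c e : Set Y, MeasurableSet a ∧ MeasurableSet b ∧ MeasurableSet c ∧ MeasurableSet e ∧
      ∀ m : MeasurableSpace Y, Measurable[m, m] T → Measurable[m, m] T.symm →
        MeasurableSet[m] a → MeasurableSet[m] b → MeasurableSet[m] c → MeasurableSet[m] e →
        mY ≤ m := by
  let K : Y → ℕ := fun x => sInf {n : ℕ | S x * (n + 1) < n}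
  have hKm : Measurable K := measurable_nat_sInf fun n =>
    measurableSet_lt (hSm.mul_const _) measurable_const
  have hKT : ∀ x, K (T x) = K x := fun x => by simp only [K, hST]
  have hK : ∀ x, S x * (K x + 1) < K x := by
    intro x
    refine Nat.sInf_mem (s := {n : ℕ | S x * (n + 1) < n}) ?_
    obtain ⟨n, hn⟩ := exists_nat_gt (S x / (1 - S x))
    refine ⟨n, ?_⟩
    rw [div_lt_iff₀ (by linarith [hS1 x])] at hn
    simp only [Set.mem_ofPred_eq]
    linarith
  obtain ⟨Z, B, hZm, hZa, hZ0, hZn, hZs, hBm, hBT, hB, hZ1⟩ :=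
    exists_adapted_hierarchy hT hT' haper hKm hKT
  let N : ℕ → Y → ℕ := fun k x => sInf {n : ℕ | k ≤ n ∧
    2 * (B (k + 2) x : ℝ) ^ 2 * (S x - ∑ i ∈ Finset.range n, s i x) < 1}
  have hNm : ∀ k, Measurable (N k) := by
    intro k
    refine measurable_nat_sInf fun n => ?_
    have hf : Measurable fun x =>
        2 * (B (k + 2) x : ℝ) ^ 2 * (S x - ∑ i ∈ Finset.range n, s i x) :=
      ((measurable_from_top (f := fun n : ℕ => 2 * (n : ℝ) ^ 2)).comp (hBm _)).mul
        (hSm.sub (Finset.measurable_fun_sum _ fun i _ => hsm i))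
    exact (MeasurableSet.const _).inter (measurableSet_lt hf measurable_const)
  have hNT : ∀ k x, N k (T x) = N k x := fun k x => by simp only [N, hBT, hST, hsT]
  have hN : ∀ k x, k ≤ N k x ∧
      2 * (B (k + 2) x : ℝ) ^ 2 * (S x - ∑ i ∈ Finset.range (N k x), s i x) < 1 := by
    intro k x
    refine Nat.sInf_mem (s := {n : ℕ | k ≤ n ∧
      2 * (B (k + 2) x : ℝ) ^ 2 * (S x - ∑ i ∈ Finset.range n, s i x) < 1}) ?_
    have hlim : Tendsto (fun n => 2 * (B (k + 2) x : ℝ) ^ 2 *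
        (S x - ∑ i ∈ Finset.range n, s i x)) atTop
        (nhds (2 * (B (k + 2) x : ℝ) ^ 2 * (S x - S x))) :=
      ((hsum x).tendsto_sum_nat.const_sub _).const_mul _
    rw [sub_self, mul_zero] at hlim
    exact ((eventually_ge_atTop k).and (hlim.eventually_lt_const one_pos)).exists
  let A₀ : Set Y := {x | label x < N 0 x}
  let A : ℕ → Set Y := fun k => {x | N k x ≤ label x ∧ label x < N (k + 1) x}
  let P : ℕ → Set Y := fun k => Z k \ Z (k + 1)
  have hPd : Pairwise fun j k => Disjoint (P j) (P k) := by
    have key : ∀ j k, j < k → Disjoint (P j) (P k) := fun j k hjk =>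
      Set.disjoint_left.2 fun x hx hx' => hx.2 (hZa hjk hx'.1)
    intro j k hjk
    rcases lt_or_gt_of_ne hjk with h | h
    · exact key j k h
    · exact (key k j h).symm
  let b : Set Y := storeCode T (fun k => P (k + 2)) A fun k => B (k + 2)
  let D : ℕ → Set Y := fun k => Nat.casesOn k A₀ fun k => nextVisitIn T (P (k + 2)) b
  let E : ℕ → Set Y := fun k => Nat.casesOn k (P 0) fun k => P (k + 2)
  have hA₀m : MeasurableSet A₀ := measurableSet_lt hlabel (hNm 0)
  have hAm : ∀ k, MeasurableSet (A k) := fun k =>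
    (measurableSet_le (hNm k) hlabel).inter (measurableSet_lt hlabel (hNm (k + 1)))
  have hPm : ∀ k, MeasurableSet (P k) := fun k => (hZm k).diff (hZm (k + 1))
  have hbm : MeasurableSet b := measurableSet_storeCode hT hT' (fun k => hPm _) hAm fun k => hBm _
  have hDm : ∀ k, MeasurableSet (D k)
    | 0 => hA₀m
    | k + 1 => measurableSet_nextVisitIn hT hT' (hPm (k + 2)) hbm
  have hEm : ∀ k, MeasurableSet (E k)
    | 0 => hPm 0
    | k + 1 => hPm (k + 2)
  have hcov : ∀ x, ∃ k, x ∈ D k := by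
    intro x
    by_cases hx : label x < N 0 x
    · exact ⟨0, hx⟩
    have hex : ∃ k, label x < N (k + 1) x := ⟨label x, (hN (label x + 1) x).1⟩
    have hmem : x ∈ A (Nat.find hex) := by
      refine ⟨?_, Nat.find_spec hex⟩
      rcases h : Nat.find hex with _ | k
      · exact not_lt.1 hx
      · exact not_lt.1 (Nat.find_min hex (m := k) (by omega))
    exact ⟨Nat.find hex + 1, mem_nextVisitIn_storeCode (P := fun k => P (k + 2))
      (B := fun k => B (k + 2)) (fun k => hBT (k + 2)) hmem (hB _ x)⟩
  have hmatch₀ : Matchable T A₀ (P 0) := by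
    intro x _
    have hlt : ∑ i ∈ Finset.range (N 0 x), s i x < (K x : ℝ) / (K x + 1) := by
      rw [lt_div_iff₀ (by positivity)]
      refine lt_of_le_of_lt ?_ (hK x)
      gcongr
      exact sum_le_hasSum _ (fun i _ => hs0 i x) (hsum x)
    obtain ⟨m, hm1, hm⟩ := exists_window_visitCount_lt (T := T) (Finset.range (N 0 x)) A₀
      (fun i => label ⁻¹' {i}) x (fun _ => x) (fun n hn => by
        have hn' : label ((T ^ n) x) < N 0 ((T ^ n) x) := hn
        rw [← zpow_natCast, apply_zpow_of_invariant (hNT 0), zpow_natCast] at hn'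
        exact ⟨_, Finset.mem_range.2 hn', rfl⟩)
      (fun i _ => hfreq i x) hlt (b := K x + 1) (by omega)
    refine ⟨(K x + 1) * m, Nat.mul_pos (by omega) hm1, ?_⟩
    have hsep := visitCount_le_of_separated (T := T) (Z := Z 1) (L := K x) (T x)
      (fun n hn i h1 hi => hZ1 _ hn i h1 (by
        rwa [← zpow_natCast, apply_zpow_of_invariant hKT, hKT])) m
    have hadd := visitCount_add_compl T (Z 1) (T x) ((K x + 1) * m)
    have hP0 : P 0 = (Z 1)ᶜ := by
      simp only [P, hZ0]
      exact (Set.compl_eq_univ_sdiff _).symm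
    have hlt' : visitCount T A₀ x ((K x + 1) * m) < K x * m := by
      have h : (K x : ℝ) / (K x + 1) * (((K x + 1 : ℕ) : ℝ) * m) = K x * m := by
        push_cast
        field_simp
      rw [h] at hm
      exact_mod_cast hm
    rw [hP0]
    have : (K x + 1) * m = K x * m + m := by ring
    omega
  have hmatch : ∀ k, Matchable T (nextVisitIn T (P (k + 2)) b) (P (k + 2)) := by
    intro k x _
    have hB1 : 1 ≤ B (k + 2) x := by
      obtain ⟨i, h1, h2, -⟩ := hB (k + 2) x
      omega
    set β := B (k + 2) x with hβ
    have horb : ∀ n : ℕ, B (k + 2) ((T ^ n) x) = β := fun n => by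
      rw [← zpow_natCast, apply_zpow_of_invariant (hBT (k + 2))]
    have hcover : ∀ n : ℕ, (T ^ n) x ∈ nextVisitIn T (P (k + 2)) b →
        ∃ p ∈ Finset.Ioo (-β : ℤ) β ×ˢ Finset.Ico (N k x) (N (k + 1) x),
          (T ^ n) ((T ^ p.1) x) ∈ label ⁻¹' {p.2} := by
      intro n hn
      obtain ⟨l, hl, hlA⟩ := exists_mem_of_mem_nextVisitIn_storeCode
        (P := fun k => P (k + 2)) (B := fun k => B (k + 2)) (fun k => hBT (k + 2))
        (fun i j hij => hPd (by omega)) (hB (k + 2) _) hn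
      rw [horb] at hl
      obtain ⟨h1, h2⟩ : N k _ ≤ label _ ∧ label _ < N (k + 1) _ := hlA
      rw [apply_zpow_of_invariant (hNT _), ← zpow_natCast, apply_zpow_of_invariant (hNT _)]
        at h1 h2
      refine ⟨(l, label ((T ^ l) ((T ^ (n : ℤ)) x))), Finset.mem_product.2
        ⟨hl, Finset.mem_Ico.2 ⟨h1, h2⟩⟩, ?_⟩
      simp only [Set.mem_preimage, Set.mem_singleton_iff]
      rw [← zpow_natCast, perm_zpow_zpow, perm_zpow_zpow, add_comm]
    have htail : ∑ i ∈ Finset.Ico (N k x) (N (k + 1) x), s i x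
        ≤ S x - ∑ i ∈ Finset.range (N k x), s i x := by
      rcases le_total (N k x) (N (k + 1) x) with hle | hle
      · rw [Finset.sum_Ico_eq_sub _ hle]
        gcongr
        exact sum_le_hasSum _ (fun i _ => hs0 i x) (hsum x)
      · rw [Finset.Ico_eq_empty (by omega), Finset.sum_empty, sub_nonneg]
        exact sum_le_hasSum _ (fun i _ => hs0 i x) (hsum x)
    have hτ0 : 0 ≤ ∑ i ∈ Finset.Ico (N k x) (N (k + 1) x), s i x :=
      Finset.sum_nonneg fun i _ => hs0 i x
    have hβ0 : (0 : ℝ) < β := by exact_mod_cast hB1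
    have hlt : ∑ p ∈ Finset.Ioo (-β : ℤ) β ×ˢ Finset.Ico (N k x) (N (k + 1) x), s p.2 x
        < 1 / β := by
      simp only [Finset.sum_product, Finset.sum_const, nsmul_eq_mul]
      rw [lt_div_iff₀ hβ0]
      have hcard : ((Finset.Ioo (-β : ℤ) β).card : ℝ) ≤ 2 * β := by
        rw [Int.card_Ioo]
        have : ((β : ℤ) - -β - 1).toNat ≤ 2 * β := by omega
        exact_mod_cast this
      have hNk := (hN k x).2
      calc _ ≤ 2 * (β : ℝ) * (S x - ∑ i ∈ Finset.range (N k x), s i x) * β := by gcongr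
        _ = 2 * (β : ℝ) ^ 2 * (S x - ∑ i ∈ Finset.range (N k x), s i x) := by ring
        _ < 1 := hNk
    obtain ⟨m, hm1, hm⟩ := exists_window_visitCount_lt (T := T) _ (nextVisitIn T (P (k + 2)) b)
      (fun p : ℤ × ℕ => label ⁻¹' {p.2}) x (fun p => (T ^ p.1) x) hcover
      (s := fun p => s p.2 x)
      (fun p _ => by
        have := hfreq p.2 ((T ^ p.1) x)
        rwa [apply_zpow_of_invariant (hsT p.2)] at this) hlt hB1
    refine ⟨β * m, Nat.mul_pos hB1 hm1, ?_⟩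
    have hsyn := le_visitCount_of_syndetic (T := T) (Z := P (k + 2)) (b := β) x
      (fun n => by
        have := hB (k + 2) ((T ^ n) x)
        rwa [horb] at this) m
    have hlt' : visitCount T (nextVisitIn T (P (k + 2)) b) x (β * m) < m := by
      have h : 1 / (β : ℝ) * (β * m) = m := by field_simp
      rw [h] at hm
      exact_mod_cast hm
    exact hlt'.le.trans hsyn
  have hDE : ∀ k, Matchable T (D k) (E k)
    | 0 => hmatch₀
    | k + 1 => hmatch k
  have hE : ∀ k, ∃ j, j ≠ 1 ∧ E k = P j ∧ (j = 0 ↔ k = 0) ∧ (k ≠ 0 → j = k + 1)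
    | 0 => ⟨0, by omega, rfl, by omega, by omega⟩
    | k + 1 => ⟨k + 2, by omega, rfl, by omega, by omega⟩
  have hEd : Pairwise fun j k => Disjoint (E j) (E k) := by
    intro j k hjk
    obtain ⟨j', -, hj, hj0, hj1⟩ := hE j
    obtain ⟨k', -, hk, hk0, hk1⟩ := hE k
    rw [hj, hk]
    exact hPd (by omega)
  have hEF : ∀ k, Disjoint (E k) (P 1) := by
    intro k
    obtain ⟨k', hne, hk, -⟩ := hE k
    rw [hk]
    exact hPd hne
  have hF : ∀ x, ∃ n : ℕ, (T ^ n) x ∈ P 1 := by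
    intro x
    obtain ⟨i, h1, -, hi⟩ := hB 1 x
    refine ⟨i.toNat, ?_⟩
    rwa [← zpow_natCast, Int.toNat_of_nonneg (by omega)]
  obtain ⟨e, hem, he⟩ := exists_generating_set hT hT' hDm hEm (hPm 1) hcov hDE hEd hEF hF
  refine ⟨A₀, b, markerCode T Z, e, hA₀m, hbm, measurableSet_markerCode hT hT' hZm, hem, ?_⟩
  intro m hmT hmT' ha hb hc hem'
  have hZ' : ∀ k, MeasurableSet[m] (Z k) :=
    @measurableSet_of_markerCode Y T Z hZa hZ0 hZn hZs m hmT hmT' hc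
  have hP' : ∀ k, MeasurableSet[m] (P k) := fun k => (hZ' k).diff (hZ' (k + 1))
  refine he m hmT (fun k => ?_) (fun k => ?_) (hP' 1) hem'
  · cases k with
    | zero => exact ha
    | succ k => exact @measurableSet_nextVisitIn Y T m hmT hmT' _ _ (hP' (k + 2)) hb
  · cases k with
    | zero => exact hP' 0
    | succ k => exact hP' (k + 2)

end Coding
section DeficientPoints

variable {X : Type*} {T : Equiv.Perm X}

/-- The upper frequency of visits of the forward orbit of `x` to `A`. -/
noncomputable def upperFreq (T : Equiv.Perm X) (A : Set X) (x : X) : ℝ :=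
  limsup (visitFreq T A x) atTop

/-- The limit superior of the partial sums of the upper frequencies of visits to the sets `α i`. -/
noncomputable def upperFreqSum (T : Equiv.Perm X) (α : ℕ → Set X) (x : X) : ℝ :=
  limsup (fun n => ∑ i ∈ Finset.range n, upperFreq T (α i) x) atTop

lemma measurable_visitFreq [MeasurableSpace X] (hT : Measurable T) {A : Set X}
    (hA : MeasurableSet A) (N : ℕ) : Measurable fun x => visitFreq T A x N := by
  refine Measurable.div_const (Finset.measurable_fun_sum _ fun i _ => ?_) _
  exact Measurable.ite (measurable_perm_pow_s3 hT i hA) measurable_const measurable_const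

lemma measurable_upperFreq [MeasurableSpace X] (hT : Measurable T) {A : Set X}
    (hA : MeasurableSet A) : Measurable (upperFreq T A) :=
  Measurable.limsup fun N => measurable_visitFreq hT hA N

lemma measurable_upperFreqSum [MeasurableSpace X] (hT : Measurable T) {α : ℕ → Set X}
    (hα : ∀ i, MeasurableSet (α i)) : Measurable (upperFreqSum T α) :=
  Measurable.limsup fun _ => Finset.measurable_fun_sum _ fun i _ => measurable_upperFreq hT (hα i)

lemma tendsto_visitFreq_apply_sub (A : Set X) (x : X) :
    Tendsto (fun N => visitFreq T A (T x) N - visitFreq T A x N) atTop (nhds 0) := by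
  have h : ∀ N, |visitFreq T A (T x) N - visitFreq T A x N| ≤ 1 / N := by
    intro N
    have hsum := Finset.sum_range_succ' (fun i => if (T ^ i) x ∈ A then (1 : ℝ) else 0) N
    rw [Finset.sum_range_succ] at hsum
    simp only [pow_succ, Equiv.Perm.mul_apply] at hsum
    rw [visitFreq, visitFreq, ← sub_div, abs_div, Nat.abs_cast]
    gcongr
    rw [abs_le]
    constructor <;> split_ifs at hsum <;> linarith
  exact squeeze_zero_norm h tendsto_one_div_atTop_nhds_zero_nat

lemma tendsto_visitFreq_apply_iff {A : Set X} {x : X} {c : ℝ} :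
    Tendsto (visitFreq T A (T x)) atTop (nhds c) ↔ Tendsto (visitFreq T A x) atTop (nhds c) := by
  have h := tendsto_visitFreq_apply_sub (T := T) A x
  constructor
  · intro hc
    simpa using hc.sub h
  · intro hc
    simpa using hc.add h

lemma apply_mem_defSet_iff {α : ℕ → Set X} (x : X) : T x ∈ defSet T α ↔ x ∈ defSet T α := by
  simp only [defSet, Set.mem_ofPred_eq, tendsto_visitFreq_apply_iff]

lemma tendsto_upperFreq {α : ℕ → Set X} {x : X} (hx : x ∈ defSet T α) (i : ℕ) :
    0 < upperFreq T (α i) x ∧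
      Tendsto (visitFreq T (α i) x) atTop (nhds (upperFreq T (α i) x)) := by
  obtain ⟨L, hL, -⟩ := hx
  have h : upperFreq T (α i) x = L i := (hL i).2.limsup_eq
  rw [h]
  exact hL i

lemma hasSum_upperFreq {α : ℕ → Set X} {x : X} (hx : x ∈ defSet T α) :
    HasSum (fun i => upperFreq T (α i) x) (upperFreqSum T α x) ∧ upperFreqSum T α x < 1 := by
  obtain ⟨L, hL, c, hc, hc1⟩ := hx
  have h : (fun i => upperFreq T (α i) x) = L := funext fun i => (hL i).2.limsup_eq
  have hS : upperFreqSum T α x = c := by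
    simp only [upperFreqSum, congrFun h]
    exact hc.tendsto_sum_nat.limsup_eq
  rw [h, hS]
  exact ⟨hc, hc1⟩

lemma measurableSet_defSet [MeasurableSpace X] (hT : Measurable T) {α : ℕ → Set X}
    (hα : ∀ i, MeasurableSet (α i)) : MeasurableSet (defSet T α) := by
  have h : defSet T α = (⋂ i, ({x | ∃ c, Tendsto (fun N => visitFreq T (α i) x N) atTop (nhds c)} ∩
      {x | 0 < upperFreq T (α i) x})) ∩
      ({x | ∃ c, Tendsto (fun n => ∑ i ∈ Finset.range n, upperFreq T (α i) x) atTop (nhds c)} ∩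
      {x | upperFreqSum T α x < 1}) := by
    ext x
    constructor
    · intro hx
      obtain ⟨hS, hS1⟩ := hasSum_upperFreq hx
      have hi := tendsto_upperFreq hx
      exact ⟨Set.mem_iInter.2 fun i => ⟨⟨_, (hi i).2⟩, (hi i).1⟩, ⟨_, hS.tendsto_sum_nat⟩, hS1⟩
    · rintro ⟨h1, ⟨c, hc⟩, hS1⟩
      rw [Set.mem_iInter] at h1
      refine ⟨fun i => upperFreq T (α i) x, fun i => ⟨(h1 i).2, ?_⟩, c, ?_, ?_⟩
      · obtain ⟨d, hd⟩ := (h1 i).1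
        have : upperFreq T (α i) x = d := hd.limsup_eq
        simpa only [this] using hd
      · exact (hasSum_iff_tendsto_nat_of_nonneg (fun i => (h1 i).2.le) c).2 hc
      · have : upperFreqSum T α x = c := hc.limsup_eq
        exact this ▸ hS1
  rw [h]
  refine MeasurableSet.inter (MeasurableSet.iInter fun i => ?_) ?_
  · exact (MeasureTheory.measurableSet_exists_tendsto fun N =>
      measurable_visitFreq hT (hα i) N).inter
      (measurableSet_lt measurable_const (measurable_upperFreq hT (hα i)))
  · exact (MeasureTheory.measurableSet_exists_tendsto fun n =>
      Finset.measurable_fun_sum _ fun i _ => measurable_upperFreq hT (hα i)).inter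
      (measurableSet_lt (measurable_upperFreqSum hT hα) measurable_const)

lemma upperFreq_apply {α : ℕ → Set X} {x : X} (hx : x ∈ defSet T α) (i : ℕ) :
    upperFreq T (α i) (T x) = upperFreq T (α i) x :=
  (tendsto_visitFreq_apply_iff.2 (tendsto_upperFreq hx i).2).limsup_eq

/-- A periodic orbit meets only finitely many sets of a partition, so it is not deficient. -/
lemma zpow_apply_ne_of_mem_defSet {α : ℕ → Set X}
    (hαd : Pairwise fun i j => Disjoint (α i) (α j)) (hαu : (⋃ i, α i) = Set.univ) {x : X}
    (hx : x ∈ defSet T α) {p : ℤ} (hp : 1 ≤ p) : (T ^ p) x ≠ x := by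
  intro hper
  lift p to ℕ using by omega
  rw [zpow_natCast] at hper
  have hlabel : ∀ y, ∃ i, y ∈ α i := fun y => Set.mem_iUnion.1 (hαu ▸ Set.mem_univ y)
  choose label hl using hlabel
  obtain ⟨j, hj⟩ := Infinite.exists_notMem_finset
    ((Finset.range p).image fun n => label ((T ^ n) x))
  have hmod : ∀ n : ℕ, (T ^ n) x = (T ^ (n % p)) x := by
    intro n
    have hmul : ∀ k : ℕ, (T ^ (p * k)) x = x := by
      intro k
      rw [pow_mul, Equiv.Perm.coe_pow]
      exact Function.iterate_fixed hper k
    conv_lhs => rw [← Nat.mod_add_div n p, pow_add, Equiv.Perm.mul_apply, hmul]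
  have hzero : visitFreq T (α j) x = fun _ => 0 := by
    funext N
    rw [visitFreq, Finset.sum_eq_zero, zero_div]
    intro n _
    rw [if_neg]
    intro hn
    refine hj (Finset.mem_image.2 ⟨n % p, Finset.mem_range.2 (Nat.mod_lt _ (by omega)), ?_⟩)
    rw [← hmod]
    by_contra hne
    exact Set.disjoint_left.1 (hαd hne) (hl _) hn
  have h := tendsto_upperFreq hx j
  rw [hzero] at h
  exact h.1.ne (tendsto_nhds_unique tendsto_const_nhds h.2)

end DeficientPoints

section FiniteGenerators

variable {X : Type*} [MeasurableSpace X] {T : Equiv.Perm X} {Y : Set X}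

open scoped MeasureTheory

/-- A system generated by four sets has a generator with sixteen sets. -/
lemma isGeneratorOn_sixteen (hT : Measurable T) (hT' : Measurable T.symm) (hY : MeasurableSet Y)
    (hYT : ∀ x, T x ∈ Y ↔ x ∈ Y) {a b c e : Set Y} (ha : MeasurableSet a) (hb : MeasurableSet b)
    (hc : MeasurableSet c) (he : MeasurableSet e)
    (hgen : ∀ m : MeasurableSpace Y, Measurable[m, m] (T.subtypePerm hYT) →
      Measurable[m, m] (T.subtypePerm hYT).symm → MeasurableSet[m] a → MeasurableSet[m] b →
      MeasurableSet[m] c → MeasurableSet[m] e → Subtype.instMeasurableSpace ≤ m) :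
    IsGeneratorOn T Y 16 := by
  let ε : Bool × Bool × Bool × Bool ≃ Fin 16 := Fintype.equivFinOfCardEq (by simp)
  let code : Y → Bool × Bool × Bool × Bool := fun y =>
    (decide (y ∈ a), decide (y ∈ b), decide (y ∈ c), decide (y ∈ e))
  have hcode : Measurable code := by
    have hd : ∀ {u : Set Y}, MeasurableSet u → Measurable fun y => decide (y ∈ u) := fun hu =>
      measurable_to_bool (by simpa [Set.preimage] using hu)
    exact (hd ha).prodMk ((hd hb).prodMk ((hd hc).prodMk (hd he)))
  let g : Y → Fin 16 := fun y => ε (code y)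
  have hg : Measurable g := (measurable_of_countable ε).comp hcode
  let TY : Equiv.Perm Y := T.subtypePerm hYT
  have hTYpow : ∀ (n : ℤ) (y : Y), ((TY ^ n) y : X) = (T ^ n) y := fun n y => by
    simp [TY, Equiv.Perm.subtypePerm_zpow]
  have hset : ∀ (n : ℤ) (i : Fin 16),
      (Subtype.val ⁻¹' (⇑(T ^ n) '' (Subtype.val '' (g ⁻¹' {i}))) : Set Y)
        = (TY ^ (-n)) ⁻¹' (g ⁻¹' {i}) := by
    intro n i
    ext y
    constructor
    · rintro ⟨-, ⟨z, hz, rfl⟩, hzy⟩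
      have : y = (TY ^ n) z := Subtype.ext (by rw [hTYpow, hzy])
      rw [this, Set.mem_preimage, perm_zpow_zpow, neg_add_cancel]
      simpa using hz
    · intro hy
      refine ⟨_, ⟨_, hy, rfl⟩, ?_⟩
      rw [← hTYpow, perm_zpow_zpow, add_neg_cancel]
      simp
  have hTYm : Measurable TY := (hT.comp measurable_subtype_coe).subtype_mk
  have hTYm' : Measurable TY.symm := (hT'.comp measurable_subtype_coe).subtype_mk
  refine ⟨fun i => Subtype.val '' (g ⁻¹' {i}), fun i =>
    hY.subtype_image (hg (measurableSet_singleton i)), fun i => ?_, fun i j hij => ?_, ?_, ?_⟩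
  · rintro - ⟨y, -, rfl⟩
    exact y.2
  · refine (Set.disjoint_image_iff Subtype.val_injective).2 (Set.disjoint_left.2 fun y h1 h2 => ?_)
    exact hij (h1.symm.trans h2)
  · ext x
    simp
  · simp only [hset]
    apply le_antisymm
    · refine MeasurableSpace.generateFrom_le ?_
      rintro - ⟨n, i, rfl⟩
      exact measurable_perm_zpow_s3 hTYm hTYm' _ (hg (measurableSet_singleton i))
    · set m := MeasurableSpace.generateFrom
        {s : Set Y | ∃ (n : ℤ) (i : Fin 16), s = (TY ^ (-n)) ⁻¹' (g ⁻¹' {i})} with hm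
      have hshift : ∀ k : ℤ, Measurable[m, m] (TY ^ k : Equiv.Perm Y) := by
        intro k
        refine @measurable_generateFrom Y Y m _ _ ?_
        rintro - ⟨n, i, rfl⟩
        refine MeasurableSpace.measurableSet_generateFrom ⟨n - k, i, ?_⟩
        ext y
        simp only [Set.mem_preimage, perm_zpow_zpow]
        rw [show -n + k = -(n - k) by ring]
      have hcell : ∀ i, MeasurableSet[m] (g ⁻¹' {i}) := fun i =>
        MeasurableSpace.measurableSet_generateFrom ⟨0, i, by simp⟩
      have hpre : ∀ J : Set (Fin 16), MeasurableSet[m] (g ⁻¹' J) := by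
        intro J
        rw [← Set.biUnion_preimage_singleton]
        exact MeasurableSet.biUnion J.to_countable fun i _ => hcell i
      have hof : ∀ f : Bool × Bool × Bool × Bool → Bool,
          MeasurableSet[m] {y | f (code y) = true} := by
        intro f
        have : {y | f (code y) = true} = g ⁻¹' {i | f (ε.symm i) = true} := by
          ext y
          simp [g]
        rw [this]
        exact hpre _
      refine hgen m ?_ ?_ ?_ ?_ ?_ ?_
      · simpa using hshift 1
      · simpa using hshift (-1)
      · simpa [code] using hof fun q => q.1
      · simpa [code] using hof fun q => q.2.1
      · simpa [code] using hof fun q => q.2.2.1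
      · simpa [code] using hof fun q => q.2.2.2

end FiniteGenerators

/-- **Generator theorem for deficient points.** If `(X,𝓑,T)` is a Borel system and
`α = {A_i}_{i∈ℕ}` is a countable Borel partition of `X`, then the restriction of `T` to the
`T`-invariant Borel set `def(α)` admits a 16-set generator. -/
theorem deficient_has_sixteen_set_generator {X : Type*} [MeasurableSpace X]
    [StandardBorelSpace X] (T : Equiv.Perm X) (hT : Measurable T) (hTinv : Measurable T.symm)
    (α : ℕ → Set X) (hαm : ∀ i, MeasurableSet (α i))
    (hαd : Pairwise fun i j => Disjoint (α i) (α j)) (hαu : (⋃ i, α i) = Set.univ) :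
    IsGeneratorOn T (defSet T α) 16 := by
  have hYm : MeasurableSet (defSet T α) := measurableSet_defSet hT hαm
  have hYT : ∀ x, T x ∈ defSet T α ↔ x ∈ defSet T α := apply_mem_defSet_iff
  have : StandardBorelSpace (defSet T α) := hYm.standardBorel
  let TY : Equiv.Perm (defSet T α) := T.subtypePerm hYT
  have hlabel : ∀ y, ∃ i, y ∈ α i := fun y => Set.mem_iUnion.1 (hαu ▸ Set.mem_univ y)
  choose label hl using hlabel
  have hlabel_eq : ∀ i, label ⁻¹' {i} = α i := by
    intro i
    ext x
    constructor
    · rintro rfl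
      exact hl x
    · intro hx
      by_contra hne
      exact Set.disjoint_left.1 (hαd hne) (hl x) hx
  have hlabelm : Measurable label := measurable_to_countable' fun i => hlabel_eq i ▸ hαm i
  have hfreq : ∀ i (y : defSet T α),
      visitFreq TY ((fun z : defSet T α => label z) ⁻¹' {i}) y = visitFreq T (α i) y := by
    intro i y
    funext N
    simp only [visitFreq, ← hlabel_eq i]
    simp [TY, Equiv.Perm.subtypePerm_pow]
  have hsT : ∀ i (y : defSet T α), upperFreq T (α i) (TY y) = upperFreq T (α i) y := fun i y =>
    upperFreq_apply y.2 i
  obtain ⟨a, b, c, e, ha, hb, hc, he, hgen⟩ := exists_four_generating_sets (T := TY)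
    (hT.comp measurable_subtype_coe).subtype_mk (hTinv.comp measurable_subtype_coe).subtype_mk
    (fun y p hp h => zpow_apply_ne_of_mem_defSet hαd hαu y.2 hp (by
      simpa [TY, Equiv.Perm.subtypePerm_zpow] using congrArg Subtype.val h))
    (label := fun y => label y) (s := fun i y => upperFreq T (α i) y)
    (S := fun y => upperFreqSum T α y) (hlabelm.comp measurable_subtype_coe)
    (fun i => (measurable_upperFreq hT (hαm i)).comp measurable_subtype_coe)
    ((measurable_upperFreqSum hT hαm).comp measurable_subtype_coe) hsT
    (fun y => by simp only [upperFreqSum, hsT]) (fun i y => (tendsto_upperFreq y.2 i).1.le)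
    (fun y => (hasSum_upperFreq y.2).1) (fun y => (hasSum_upperFreq y.2).2)
    (fun i y => hfreq i y ▸ (tendsto_upperFreq y.2 i).2)
  exact isGeneratorOn_sixteen hT hTinv hYm hYT ha hb hc he hgen
end
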